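/- arXiv:2410.18878 — 3 statements merged into one kernel-verified Lean document; each statement's English description precedes it below -/
import Mathlib

section
/- Let (G,w) be a weighted graph, k ≥ 1 an integer, C a cycle in G of weight at most ℓ, and P a path in G of weight at most ℓ that shares at least one vertex with C. If P has at least 128k³ chords relative to C, then G contains a collection of k pairwise vertex-disjoint cycles of total weight at most ℓ. -/
open SimpleGraph

/-- A transitive relation on a finite set with at least `a * b` elements has a chain of length `a`
or an antichain with `b` elements. -/
theorem exists_chain_or_antichain {α : Type*} [DecidableEq α] (r : α → α → Prop)
    (htrans : ∀ x y z, r x y → r y z → r x z) {b : ℕ} (hb : 1 ≤ b) (a : ℕ) :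
    ∀ S : Finset α, a * b ≤ S.card →
      (∃ L : List α, L.length = a ∧ L.Pairwise r ∧ ∀ x ∈ L, x ∈ S) ∨
      ∃ T ⊆ S, b ≤ T.card ∧ ∀ x ∈ T, ∀ y ∈ T, ¬ r x y := by
  classical
  induction a with
  | zero => exact fun S _ => Or.inl ⟨[], by simp⟩
  | succ a ih =>
    intro S hS
    have hab : (a + 1) * b = a * b + b := by ring
    set T := S.filter (fun x => ∀ y ∈ S, ¬ r y x) with hT
    have hTS : T ⊆ S := Finset.filter_subset _ _
    by_cases hbT : b ≤ T.card
    · refine Or.inr ⟨T, hTS, hbT, fun x hx y hy => ?_⟩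
      exact (Finset.mem_filter.1 hy).2 x (hTS hx)
    have hcard : a * b ≤ (S \ T).card := by
      rw [Finset.card_sdiff_of_subset hTS]; omega
    rcases ih _ hcard with ⟨L, hL, hLr, hLS⟩ | ⟨U, hU, hbU, hUr⟩
    · left
      cases L with
      | nil =>
        obtain ⟨x, hx⟩ : S.Nonempty := Finset.card_pos.1 (by omega)
        exact ⟨[x], by simpa using hL.symm, by simp, by simpa using hx⟩
      | cons h L =>
        have hh := Finset.mem_sdiff.1 (hLS h (by simp))
        obtain ⟨y, hy, hyr⟩ : ∃ y ∈ S, r y h := by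
          by_contra! hcon
          exact hh.2 (Finset.mem_filter.2 ⟨hh.1, hcon⟩)
        refine ⟨y :: h :: L, by simpa using hL, List.pairwise_cons.2 ⟨?_, hLr⟩, ?_⟩
        · intro z hz
          rcases List.mem_cons.1 hz with rfl | hz
          · exact hyr
          · exact htrans _ _ _ hyr ((List.pairwise_cons.1 hLr).1 z hz)
        · intro z hz
          rcases List.mem_cons.1 hz with rfl | hz
          · exact hy
          · exact (Finset.mem_sdiff.1 (hLS z hz)).1
    · exact Or.inr ⟨U, hU.trans Finset.sdiff_subset, hbU, hUr⟩

/-- A function-valued form of `exists_chain_or_antichain`. -/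
theorem exists_fin_chain_or_antichain {α : Type*} [DecidableEq α] (r : α → α → Prop)
    (htrans : ∀ x y z, r x y → r y z → r x z) {b : ℕ} (hb : 1 ≤ b) (a : ℕ)
    (S : Finset α) (hS : a * b ≤ S.card) :
    (∃ f : Fin a → α, (∀ i j, i < j → r (f i) (f j)) ∧ ∀ i, f i ∈ S) ∨
      ∃ T ⊆ S, b ≤ T.card ∧ ∀ x ∈ T, ∀ y ∈ T, ¬ r x y := by
  refine (exists_chain_or_antichain r htrans hb a S hS).imp_left ?_
  rintro ⟨L, rfl, hL, hLS⟩
  exact ⟨L.get, fun i j hij => List.pairwise_iff_get.1 hL i j hij,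
    fun i => hLS _ (List.get_mem L i)⟩

namespace SimpleGraph.Walk

variable {V : Type*} {G : SimpleGraph V}

/-- A path and a walk with the same ends, where the path has an edge not on the walk, together
contain a cycle. -/
theorem exists_isCycle_of_isPath [DecidableEq V] {x y : V} (A B : G.Walk x y) (hB : B.IsPath)
    {e : Sym2 V} (he : e ∈ B.edges) (he' : e ∉ A.edges) :
    ∃ (v : V) (D : G.Walk v v), D.IsCycle ∧ ∀ f ∈ D.edges, f ∈ A.edges ∨ f ∈ B.edges := by
  classical
  set F : SimpleGraph V := fromEdgeSet {f | f ∈ A.edges ∨ f ∈ B.edges} with hF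
  have hFe : ∀ f, f ∈ F.edgeSet ↔ (f ∈ A.edges ∨ f ∈ B.edges) := by
    intro f
    rw [hF, edgeSet_fromEdgeSet, Set.mem_sdiff]
    refine ⟨fun h => h.1, fun h => ⟨h, fun hd => ?_⟩⟩
    have hG : f ∈ G.edgeSet := h.elim (fun h => A.edges_subset_edgeSet h)
      (fun h => B.edges_subset_edgeSet h)
    exact G.not_isDiag_of_mem_edgeSet hG hd
  have hA : ∀ f ∈ A.edges, f ∈ F.edgeSet := fun f hf => (hFe f).2 (Or.inl hf)
  have hB' : ∀ f ∈ B.edges, f ∈ F.edgeSet := fun f hf => (hFe f).2 (Or.inr hf)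
  have hcyc : ¬ F.IsAcyclic := by
    intro hac
    have h := (hac.subsingleton_path x y).elim ⟨(A.transfer F hA).bypass, bypass_isPath _⟩
      ⟨B.transfer F hB', hB.transfer hB'⟩
    have h' : (A.transfer F hA).bypass = B.transfer F hB' := congrArg Subtype.val h
    have h1 : e ∈ (B.transfer F hB').edges := by simpa using he
    rw [← h'] at h1
    have h2 := edges_bypass_subset_edges _ h1
    exact he' (by simpa using h2)
  unfold IsAcyclic at hcyc
  push Not at hcyc
  obtain ⟨v, D, hD⟩ := hcyc
  have hDF : ∀ f ∈ D.edges, f ∈ A.edges ∨ f ∈ B.edges := fun f hf =>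
    (hFe f).1 (D.edges_subset_edgeSet hf)
  have hDG : ∀ f ∈ D.edges, f ∈ G.edgeSet := fun f hf =>
    (hDF f hf).elim (fun h => A.edges_subset_edgeSet h) (fun h => B.edges_subset_edgeSet h)
  exact ⟨v, D.transfer G hDG, hD.transfer hDG, by simpa using hDF⟩

/-- The segment of a walk between two positions. -/
theorem exists_segment {s t : V} (Q : G.Walk s t) {i j : ℕ} (hij : i ≤ j) (hj : j ≤ Q.length) :
    ∃ A : G.Walk (Q.getVert i) (Q.getVert j), (∀ e ∈ A.edges, e ∈ Q.edges) ∧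
      ∀ v ∈ A.support, ∃ n, i ≤ n ∧ n ≤ j ∧ v = Q.getVert n := by
  induction j, hij using Nat.le_induction with
  | base => exact ⟨nil, by simp, fun v hv => ⟨i, le_rfl, le_rfl, by simpa using hv⟩⟩
  | succ j hij ih =>
    obtain ⟨A, hA, hA'⟩ := ih (by omega)
    have hadj := Q.adj_getVert_succ (i := j) (by omega)
    have hmem : s(Q.getVert j, Q.getVert (j + 1)) ∈ Q.edges :=
      Q.mk_mem_edges_iff_exists.2 ⟨j, by omega, rfl⟩
    refine ⟨A.concat hadj, ?_, ?_⟩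
    · intro e he
      rw [edges_concat, List.concat_eq_append, List.mem_append, List.mem_singleton] at he
      rcases he with he | rfl
      · exact hA e he
      · exact hmem
    · intro v hv
      rw [support_concat, List.mem_append, List.mem_singleton] at hv
      rcases hv with hv | rfl
      · obtain ⟨n, h1, h2, h3⟩ := hA' v hv
        exact ⟨n, h1, by omega, h3⟩
      · exact ⟨j + 1, by omega, le_rfl, rfl⟩

/-- The segment of a walk between two positions, in either direction. -/
theorem exists_segment_uIcc {s t : V} (Q : G.Walk s t) {i j : ℕ} (hi : i ≤ Q.length)
    (hj : j ≤ Q.length) :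
    ∃ A : G.Walk (Q.getVert i) (Q.getVert j), (∀ e ∈ A.edges, e ∈ Q.edges) ∧
      ∀ v ∈ A.support, ∃ n ∈ Set.uIcc i j, n ≤ Q.length ∧ v = Q.getVert n := by
  rcases le_total i j with h | h
  · obtain ⟨A, hA, hA'⟩ := Q.exists_segment h hj
    refine ⟨A, hA, fun v hv => ?_⟩
    obtain ⟨n, h1, h2, h3⟩ := hA' v hv
    exact ⟨n, Set.mem_uIcc.2 (Or.inl ⟨h1, h2⟩), h2.trans hj, h3⟩
  · obtain ⟨A, hA, hA'⟩ := Q.exists_segment h hi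
    refine ⟨A.reverse, by simpa using hA, fun v hv => ?_⟩
    obtain ⟨n, h1, h2, h3⟩ := hA' v (by simpa using hv)
    exact ⟨n, Set.mem_uIcc.2 (Or.inr ⟨h1, h2⟩), h2.trans hi, h3⟩

theorem mem_support_of_mem_edges_of_mem {x y : V} (A : G.Walk x y) {e : Sym2 V} {v : V}
    (he : e ∈ A.edges) (hv : v ∈ e) : v ∈ A.support := by
  induction e with
  | _ a b =>
    rcases Sym2.mem_iff.1 hv with rfl | rfl
    · exact A.fst_mem_support_of_mem_edges he
    · exact A.snd_mem_support_of_mem_edges he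

end SimpleGraph.Walk

namespace SimpleGraph

/-- A family of pairwise disjoint paths joining distinct vertices of the walk `Q`, with no inner
vertex on `Q` and no edge of `Q`. The ends are recorded by their positions on `Q`. -/
structure ChordFamily {V : Type*} {G : SimpleGraph V} {s t : V} (Q : G.Walk s t)
    (ι : Type*) where
  left : ι → ℕ
  right : ι → ℕ
  left_lt_right : ∀ i, left i < right i
  right_le : ∀ i, right i ≤ Q.length
  walk : ∀ i, G.Walk (Q.getVert (left i)) (Q.getVert (right i))
  isPath : ∀ i, (walk i).IsPath
  length_pos : ∀ i, 0 < (walk i).length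
  disjoint : ∀ i j, i ≠ j → ∀ x, x ∈ (walk i).support → x ∉ (walk j).support
  eq_or_eq : ∀ i, ∀ n ≤ Q.length, Q.getVert n ∈ (walk i).support → n = left i ∨ n = right i
  notMem_edges : ∀ i, ∀ e ∈ (walk i).edges, e ∉ Q.edges

namespace ChordFamily

variable {V : Type*} {G : SimpleGraph V} {s t : V} {Q : G.Walk s t} {ι : Type*}
  (H : ChordFamily Q ι)

theorem getVert_left_mem (i : ι) : Q.getVert (H.left i) ∈ (H.walk i).support :=
  Walk.start_mem_support _

theorem getVert_right_mem (i : ι) : Q.getVert (H.right i) ∈ (H.walk i).support :=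
  Walk.end_mem_support _

theorem left_ne_left {i j : ι} (hij : i ≠ j) : H.left i ≠ H.left j := fun h =>
  H.disjoint i j hij _ (H.getVert_left_mem i) (by rw [h]; exact H.getVert_left_mem j)

theorem left_ne_right {i j : ι} (hij : i ≠ j) : H.left i ≠ H.right j := fun h =>
  H.disjoint i j hij _ (H.getVert_left_mem i) (by rw [h]; exact H.getVert_right_mem j)

theorem right_ne_right {i j : ι} (hij : i ≠ j) : H.right i ≠ H.right j := fun h =>
  H.disjoint i j hij _ (H.getVert_right_mem i) (by rw [h]; exact H.getVert_right_mem j)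

/-- There is a cycle made of edges of `Q` and of the chords, which meets `Q` only in positions
from `I` and uses only chords with both ends in `I`. -/
def HasCycleOn (I : Set ℕ) : Prop :=
  ∃ (v : V) (D : G.Walk v v), D.IsCycle ∧
    (∀ e ∈ D.edges, e ∈ Q.edges ∨ ∃ i, e ∈ (H.walk i).edges) ∧
    ∀ x ∈ D.support, (∃ n ∈ I, n ≤ Q.length ∧ x = Q.getVert n) ∨
      ∃ i, H.left i ∈ I ∧ H.right i ∈ I ∧ x ∈ (H.walk i).support

/-- Closing a chord by a walk that avoids it gives a cycle. -/
theorem hasCycleOn_of_walk [DecidableEq V] {I : Set ℕ} (i : ι)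
    (hl : H.left i ∈ I) (hr : H.right i ∈ I)
    (A : G.Walk (Q.getVert (H.left i)) (Q.getVert (H.right i)))
    (hAe : ∀ e ∈ A.edges, e ∈ Q.edges ∨ ∃ j, j ≠ i ∧ e ∈ (H.walk j).edges)
    (hAs : ∀ x ∈ A.support, (∃ n ∈ I, n ≤ Q.length ∧ x = Q.getVert n) ∨
      ∃ j, H.left j ∈ I ∧ H.right j ∈ I ∧ x ∈ (H.walk j).support) :
    H.HasCycleOn I := by
  obtain ⟨e, he⟩ : ∃ e, e ∈ (H.walk i).edges := by
    apply List.exists_mem_of_length_pos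
    rw [Walk.length_edges]
    exact H.length_pos i
  have heA : e ∉ A.edges := by
    intro h
    rcases hAe e h with h | ⟨j, hj, h⟩
    · exact H.notMem_edges i e he h
    · obtain ⟨x, hx⟩ : ∃ x, x ∈ e := ⟨_, e.out_fst_mem⟩
      exact H.disjoint j i hj x (Walk.mem_support_of_mem_edges_of_mem _ h hx)
        (Walk.mem_support_of_mem_edges_of_mem _ he hx)
  obtain ⟨v, D, hD, hDe⟩ := Walk.exists_isCycle_of_isPath A (H.walk i) (H.isPath i) he heA
  refine ⟨v, D, hD, fun f hf => ?_, fun x hx => ?_⟩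
  · rcases hDe f hf with h | h
    · exact (hAe f h).imp_right fun ⟨j, _, hj⟩ => ⟨j, hj⟩
    · exact Or.inr ⟨i, h⟩
  · obtain ⟨f, hf, hxf⟩ := (Walk.mem_support_iff_exists_mem_edges_of_not_nil hD.not_nil).1 hx
    rcases hDe f hf with h | h
    · exact hAs x (Walk.mem_support_of_mem_edges_of_mem _ h hxf)
    · exact Or.inr ⟨i, hl, hr, Walk.mem_support_of_mem_edges_of_mem _ h hxf⟩

theorem hasCycleOn_Icc [DecidableEq V] (i : ι) :
    H.HasCycleOn (Set.Icc (H.left i) (H.right i)) := by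
  have hlt := H.left_lt_right i
  obtain ⟨A, hA, hA'⟩ := Q.exists_segment hlt.le (H.right_le i)
  refine H.hasCycleOn_of_walk i ⟨le_rfl, hlt.le⟩ ⟨hlt.le, le_rfl⟩ A
    (fun e he => Or.inl (hA e he)) fun x hx => Or.inl ?_
  obtain ⟨n, h1, h2, h3⟩ := hA' x hx
  exact ⟨n, ⟨h1, h2⟩, h2.trans (H.right_le i), h3⟩

theorem hasCycleOn_pair [DecidableEq V] {i j : ι} (hij : i ≠ j) :
    H.HasCycleOn (Set.uIcc (H.left i) (H.left j) ∪ Set.uIcc (H.right i) (H.right j)) := by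
  have hi := H.left_lt_right i
  have hj := H.left_lt_right j
  have hi' := H.right_le i
  have hj' := H.right_le j
  obtain ⟨A, hA, hA'⟩ := Q.exists_segment_uIcc (i := H.left i) (j := H.left j)
    (by omega) (by omega)
  obtain ⟨B, hB, hB'⟩ := Q.exists_segment_uIcc (i := H.right j) (j := H.right i)
    (by omega) (by omega)
  refine H.hasCycleOn_of_walk i (Or.inl Set.left_mem_uIcc) (Or.inr Set.left_mem_uIcc)
    ((A.append (H.walk j)).append B) (fun e he => ?_) fun x hx => ?_
  · rw [Walk.edges_append, Walk.edges_append, List.mem_append, List.mem_append] at he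
    rcases he with (he | he) | he
    · exact Or.inl (hA e he)
    · exact Or.inr ⟨j, hij.symm, he⟩
    · exact Or.inl (hB e he)
  · rw [Walk.mem_support_append_iff, Walk.mem_support_append_iff] at hx
    rcases hx with (hx | hx) | hx
    · obtain ⟨n, h1, h2, h3⟩ := hA' x hx
      exact Or.inl ⟨n, Or.inl h1, h2, h3⟩
    · exact Or.inr ⟨j, Or.inl Set.right_mem_uIcc, Or.inr Set.right_mem_uIcc, hx⟩
    · obtain ⟨n, h1, h2, h3⟩ := hB' x hx
      exact Or.inl ⟨n, Or.inr (Set.uIcc_comm (H.right j) _ ▸ h1), h2, h3⟩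

/-- There are `K` pairwise disjoint cycles made of edges of `Q` and of the chords. -/
def HasDisjointCycles (K : ℕ) : Prop :=
  ∃ (v : Fin K → V) (D : (i : Fin K) → G.Walk (v i) (v i)),
    (∀ i, (D i).IsCycle) ∧
    (∀ i j, i ≠ j → ∀ x, x ∈ (D i).support → x ∉ (D j).support) ∧
    ∀ i, ∀ e ∈ (D i).edges, e ∈ Q.edges ∨ ∃ j, e ∈ (H.walk j).edges

theorem hasDisjointCycles_of_hasCycleOn (hQ : Q.IsPath) {K : ℕ} (I : Fin K → Set ℕ)
    (hI : ∀ i j, i < j → ∀ n, n ∈ I i → n ∉ I j) (hc : ∀ i, H.HasCycleOn (I i)) :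
    H.HasDisjointCycles K := by
  have hI' : ∀ i j, i ≠ j → ∀ n, n ∈ I i → n ∉ I j := by
    intro i j hij n hi hj
    rcases lt_or_gt_of_ne hij with h | h
    · exact hI i j h n hi hj
    · exact hI j i h n hj hi
  choose v D hD hDe hDs using hc
  refine ⟨v, D, hD, fun i j hij x hi hj => ?_, hDe⟩
  rcases hDs i x hi with ⟨n, hn, hnQ, rfl⟩ | ⟨a, hal, har, ha⟩
  · rcases hDs j _ hj with ⟨m, hm, hmQ, hnm⟩ | ⟨b, hbl, hbr, hb⟩
    · obtain rfl : n = m := hQ.getVert_injOn hnQ hmQ hnm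
      exact hI' i j hij n hn hm
    · rcases H.eq_or_eq b n hnQ hb with rfl | rfl
      · exact hI' i j hij _ hn hbl
      · exact hI' i j hij _ hn hbr
  · rcases hDs j x hj with ⟨m, hm, hmQ, rfl⟩ | ⟨b, hbl, hbr, hb⟩
    · rcases H.eq_or_eq a m hmQ ha with rfl | rfl
      · exact hI' i j hij _ hal hm
      · exact hI' i j hij _ har hm
    · by_cases hab : a = b
      · subst hab
        exact hI' i j hij _ hal hbl
      · exact H.disjoint a b hab x ha hb

/-- Pairing up consecutive chords of a chain of pairwise nested chords. -/
theorem hasDisjointCycles_of_nested [DecidableEq V] (hQ : Q.IsPath) {K : ℕ} (f : Fin (2 * K) → ι)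
    (hf : ∀ i j, i < j → H.left (f i) < H.left (f j) ∧ H.right (f j) < H.right (f i)) :
    H.HasDisjointCycles K := by
  have hf' : ∀ a b (ha : a < 2 * K) (hb : b < 2 * K), a < b →
      H.left (f ⟨a, ha⟩) < H.left (f ⟨b, hb⟩) ∧ H.right (f ⟨b, hb⟩) < H.right (f ⟨a, ha⟩) :=
    fun a b ha hb h => hf _ _ h
  refine H.hasDisjointCycles_of_hasCycleOn hQ (fun i : Fin K =>
    Set.uIcc (H.left (f ⟨2 * i, by omega⟩)) (H.left (f ⟨2 * i + 1, by omega⟩)) ∪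
    Set.uIcc (H.right (f ⟨2 * i, by omega⟩)) (H.right (f ⟨2 * i + 1, by omega⟩))) ?_ ?_
  · intro i j hij n hi hj
    have hij' : (i : ℕ) < j := hij
    have h1 := hf' (2 * i) (2 * i + 1) (by omega) (by omega) (by omega)
    have h2 := hf' (2 * i + 1) (2 * j) (by omega) (by omega) (by omega)
    have h3 := hf' (2 * j) (2 * j + 1) (by omega) (by omega) (by omega)
    have h4 := H.left_lt_right (f ⟨2 * j + 1, by omega⟩)
    simp only [Set.mem_union, Set.mem_uIcc] at hi hj
    omega
  · intro i
    refine H.hasCycleOn_pair fun h => ?_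
    have h1 := hf' (2 * i) (2 * i + 1) (by omega) (by omega) (by omega)
    rw [h] at h1
    omega

/-- Pairing up consecutive chords of a chain of pairwise crossing chords. -/
theorem hasDisjointCycles_of_crossing [DecidableEq V] (hQ : Q.IsPath) {K : ℕ}
    (f : Fin (2 * K) → ι)
    (hf : ∀ i j, i < j → H.left (f i) < H.left (f j) ∧ H.left (f j) < H.right (f i) ∧
      H.right (f i) < H.right (f j)) :
    H.HasDisjointCycles K := by
  have hf' : ∀ a b (ha : a < 2 * K) (hb : b < 2 * K), a < b →
      H.left (f ⟨a, ha⟩) < H.left (f ⟨b, hb⟩) ∧ H.left (f ⟨b, hb⟩) < H.right (f ⟨a, ha⟩) ∧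
      H.right (f ⟨a, ha⟩) < H.right (f ⟨b, hb⟩) :=
    fun a b ha hb h => hf _ _ h
  refine H.hasDisjointCycles_of_hasCycleOn hQ (fun i : Fin K =>
    Set.uIcc (H.left (f ⟨2 * i, by omega⟩)) (H.left (f ⟨2 * i + 1, by omega⟩)) ∪
    Set.uIcc (H.right (f ⟨2 * i, by omega⟩)) (H.right (f ⟨2 * i + 1, by omega⟩))) ?_ ?_
  · intro i j hij n hi hj
    have hij' : (i : ℕ) < j := hij
    have h1 := hf' (2 * i) (2 * i + 1) (by omega) (by omega) (by omega)
    have h2 := hf' (2 * i + 1) (2 * j) (by omega) (by omega) (by omega)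
    have h3 := hf' (2 * j) (2 * j + 1) (by omega) (by omega) (by omega)
    have h4 := hf' (2 * i) (2 * j + 1) (by omega) (by omega) (by omega)
    simp only [Set.mem_union, Set.mem_uIcc] at hi hj
    omega
  · intro i
    refine H.hasCycleOn_pair fun h => ?_
    have h1 := hf' (2 * i) (2 * i + 1) (by omega) (by omega) (by omega)
    rw [h] at h1
    omega

theorem hasDisjointCycles_of_separated [DecidableEq V] (hQ : Q.IsPath) {K : ℕ} (f : Fin K → ι)
    (hf : ∀ i j, i < j → H.right (f i) < H.left (f j)) :
    H.HasDisjointCycles K := by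
  refine H.hasDisjointCycles_of_hasCycleOn hQ
    (fun i => Set.Icc (H.left (f i)) (H.right (f i))) ?_ fun i => H.hasCycleOn_Icc _
  intro i j hij n hi hj
  have h1 := hf i j hij
  have h2 := hi.2
  have h3 := hj.1
  omega

/-- A family of `8 * K ^ 3` chords of a path yields `K` disjoint cycles: it contains `K` pairwise
separated, `2 * K` pairwise nested or `2 * K` pairwise crossing chords. -/
theorem hasDisjointCycles [DecidableEq V] [Fintype ι] (hQ : Q.IsPath) {K : ℕ} (hK : 1 ≤ K)
    (hcard : 8 * K ^ 3 ≤ Fintype.card ι) : H.HasDisjointCycles K := by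
  classical
  rcases exists_fin_chain_or_antichain (fun i j => H.right i < H.left j)
    (fun x y z hxy hyz => hxy.trans ((H.left_lt_right y).trans hyz))
    (b := 2 * K * (4 * K)) (by nlinarith) K Finset.univ
    (by rw [Finset.card_univ]; refine le_trans (le_of_eq ?_) hcard; ring) with
    ⟨f, hf, -⟩ | ⟨S, -, hS, hSr⟩
  · exact H.hasDisjointCycles_of_separated hQ f hf
  rcases exists_fin_chain_or_antichain
    (fun i j => H.left i < H.left j ∧ H.right j < H.right i)
    (fun x y z hxy hyz => ⟨hxy.1.trans hyz.1, hyz.2.trans hxy.2⟩)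
    (b := 4 * K) (by omega) (2 * K) S hS with
    ⟨f, hf, -⟩ | ⟨T, hTS, hT, hTr⟩
  · exact H.hasDisjointCycles_of_nested hQ f hf
  rcases exists_fin_chain_or_antichain (fun i j => H.left i < H.left j)
    (fun x y z hxy hyz => hxy.trans hyz) (b := 2) (by omega) (2 * K) T (by omega) with
    ⟨f, hf, hfT⟩ | ⟨U, -, hU, hUr⟩
  · refine H.hasDisjointCycles_of_crossing hQ f fun i j hij => ?_
    have h1 := hf i j hij
    have hne : f i ≠ f j := fun h => by rw [h] at h1; omega
    have h2 := hSr _ (hTS (hfT i)) _ (hTS (hfT j))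
    have h3 := hTr _ (hfT i) _ (hfT j)
    have h4 := H.left_ne_right hne.symm
    have h5 := H.right_ne_right hne
    omega
  · obtain ⟨x, hx, y, hy, hxy⟩ := Finset.one_lt_card.1 hU
    have h1 := hUr x hx y hy
    have h2 := hUr y hy x hx
    have h3 := H.left_ne_left hxy
    omega

end ChordFamily
end SimpleGraph

namespace SimpleGraph.Walk

variable {V : Type*} {G : SimpleGraph V}

/-- The part of the path `p` between positions `i` and `j` is a chord relative to `c`. -/
def IsChordAt {u a b : V} (c : G.Walk u u) (p : G.Walk a b) (i j : ℕ) : Prop :=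
  i < j ∧ j ≤ p.length ∧ p.getVert i ∈ c.support ∧ p.getVert j ∈ c.support ∧
    (∀ n, i < n → n < j → p.getVert n ∉ c.support) ∧
    ∃ R : G.Walk (p.getVert i) (p.getVert j), R.IsPath ∧ 0 < R.length ∧
      (∀ e ∈ R.edges, e ∈ p.edges) ∧ (∀ e ∈ R.edges, e ∉ c.edges) ∧
      ∀ v ∈ R.support, ∃ n, i ≤ n ∧ n ≤ j ∧ v = p.getVert n

theorem exists_getVert_eq_of_support_isInfix {a b x y : V} {p : G.Walk a b} {R : G.Walk x y}
    (h : R.support.IsInfix p.support) :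
    ∃ i, i + R.length ≤ p.length ∧ (∀ n ≤ R.length, R.getVert n = p.getVert (i + n)) ∧
      R.support = (p.support.drop i).take (R.length + 1) := by
  obtain ⟨l₁, l₂, h⟩ := h
  have hlen := congrArg List.length h
  simp only [List.length_append, length_support] at hlen
  refine ⟨l₁.length, by omega, fun n hn => ?_, ?_⟩
  · rw [getVert_eq_support_getElem _ hn, getVert_eq_support_getElem _ (by omega)]
    simp only [← h]
    rw [List.getElem_append_left (by simp; omega), List.getElem_append_right (by omega)]
    simp
  · rw [← h, List.append_assoc, List.drop_left, ← length_support, List.take_left]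

theorem exists_isChordAt {u a b x y : V} {c : G.Walk u u} {p : G.Walk a b} (hp : p.IsPath)
    {R : G.Walk x y} (hR : R.IsPath) (hlen : 0 < R.length) (hinf : R.support.IsInfix p.support)
    (hx : x ∈ c.support) (hy : y ∈ c.support)
    (hint : ∀ v ∈ R.support, v ≠ x → v ≠ y → v ∉ c.support)
    (hedge : ∀ e ∈ R.edges, e ∉ c.edges) :
    ∃ i j, IsChordAt c p i j ∧ R.support = (p.support.drop i).take (j - i + 1) := by
  obtain ⟨i, hi, hget, hsupp⟩ := exists_getVert_eq_of_support_isInfix hinf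
  obtain ⟨L, hL⟩ : ∃ L, R.length = L := ⟨_, rfl⟩
  rw [hL] at hlen hi hget hsupp
  have hx' : x = p.getVert i := by simpa using hget 0 (by omega)
  have hy' : y = p.getVert (i + L) := by simpa [← hL] using hget L le_rfl
  subst hx' hy'
  refine ⟨i, i + L, ⟨by omega, hi, hx, hy, fun n h1 h2 => ?_,
    R, hR, by omega, fun e he => ?_, hedge, fun v hv => ?_⟩, by simpa using hsupp⟩
  · refine hint _ ?_ ?_ ?_
    · have h3 := hget (n - i) (by omega)
      rw [Nat.add_sub_cancel' h1.le] at h3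
      rw [← h3]
      exact R.getVert_mem_support _
    · intro h
      have : n = i := hp.getVert_injOn (show n ≤ p.length by omega) (show i ≤ p.length by omega) h
      omega
    · intro h
      have : n = i + L := hp.getVert_injOn (show n ≤ p.length by omega) hi h
      omega
  · induction e with
    | _ v w =>
      obtain ⟨n, hn, hvw⟩ := R.mk_mem_edges_iff_exists.1 he
      rw [hL] at hn
      rw [hget n hn.le, hget (n + 1) hn, ← add_assoc] at hvw
      exact p.mk_mem_edges_iff_exists.2 ⟨i + n, by omega, hvw⟩
  · obtain ⟨n, rfl, hn⟩ := mem_support_iff_exists_getVert.1 hv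
    rw [hL] at hn
    exact ⟨i + n, by omega, by omega, hget n hn⟩

theorem IsChordAt.le_of_lt {u a b : V} {c : G.Walk u u} {p : G.Walk a b} {i j i' : ℕ}
    (h : IsChordAt c p i j) (hi : i < i') (hi' : p.getVert i' ∈ c.support) : j ≤ i' := by
  by_contra! hlt
  exact h.2.2.2.2.1 i' hi hlt hi'

theorem IsChordAt.right_unique {u a b : V} {c : G.Walk u u} {p : G.Walk a b} {i j j' : ℕ}
    (h : IsChordAt c p i j) (hu : IsChordAt c p i j') : j = j' :=
  le_antisymm (h.le_of_lt hu.1 hu.2.2.2.1) (hu.le_of_lt h.1 h.2.2.2.1)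

/-- Half of the chords, namely every second one, can be chosen pairwise disjoint. -/
theorem exists_disjoint_isChordAt {u a b : V} {c : G.Walk u u} {p : G.Walk a b} (T : Finset ℕ)
    (hT : ∀ i ∈ T, ∃ j, IsChordAt c p i j) {N : ℕ} (hN : 2 * N ≤ T.card) :
    ∃ f g : Fin N → ℕ, (∀ i, IsChordAt c p (f i) (g i)) ∧ ∀ i j, i < j → g i < f j := by
  choose! g hg using hT
  set o := T.orderEmbOfFin rfl
  have ho : ∀ n, o n ∈ T := fun n => T.orderEmbOfFin_mem rfl n
  refine ⟨fun i => o ⟨2 * i, by omega⟩, fun i => g (o ⟨2 * i, by omega⟩),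
    fun i => hg _ (ho _), fun i j hij => ?_⟩
  have hij' : (i : ℕ) < j := hij
  have h1 : o ⟨2 * i, by omega⟩ < o ⟨2 * i + 1, by omega⟩ :=
    o.strictMono (Fin.mk_lt_mk.2 (by omega))
  have h2 : o ⟨2 * i + 1, by omega⟩ < o ⟨2 * j, by omega⟩ :=
    o.strictMono (Fin.mk_lt_mk.2 (by omega))
  exact ((hg _ (ho _)).le_of_lt h1 (hg _ (ho _)).2.2.1).trans_lt h2

/-- A walk between distinct vertices of a path `Q` can be oriented along `Q`. -/
theorem exists_oriented {s t x y : V} {Q : G.Walk s t} (hQ : Q.IsPath) (hx : x ∈ Q.support)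
    (hy : y ∈ Q.support) (hxy : x ≠ y) (R : G.Walk x y) (hR : R.IsPath) :
    ∃ l r, l < r ∧ r ≤ Q.length ∧
      (∀ n ≤ Q.length, Q.getVert n = x ∨ Q.getVert n = y → n = l ∨ n = r) ∧
      ∃ R' : G.Walk (Q.getVert l) (Q.getVert r), R'.IsPath ∧ R'.length = R.length ∧
        (∀ e ∈ R'.edges, e ∈ R.edges) ∧ ∀ v ∈ R'.support, v ∈ R.support := by
  obtain ⟨m, rfl, hm⟩ := mem_support_iff_exists_getVert.1 hx
  obtain ⟨n, rfl, hn⟩ := mem_support_iff_exists_getVert.1 hy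
  rcases lt_trichotomy m n with h | rfl | h
  · exact ⟨m, n, h, hn, fun q hq => Or.imp (fun h => hQ.getVert_injOn hq hm h)
      (fun h => hQ.getVert_injOn hq hn h), R, hR, rfl, fun _ h => h, fun _ h => h⟩
  · exact absurd rfl hxy
  · exact ⟨n, m, h, hm, fun q hq hor => (Or.imp (fun h => hQ.getVert_injOn hq hm h)
      (fun h => hQ.getVert_injOn hq hn h) hor).symm, R.reverse, hR.reverse, by simp,
      by simp, by simp⟩

/-- Disjoint chords relative to a cycle form a chord family of the cycle with one edge removed. -/
theorem exists_chordFamily {u a b : V} {c : G.Walk u u} (hc : c.IsCycle) {p : G.Walk a b}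
    (hp : p.IsPath) {N : ℕ} (f g : Fin N → ℕ) (hfg : ∀ i, IsChordAt c p (f i) (g i))
    (hlt : ∀ i j, i < j → g i < f j) :
    ∃ H : ChordFamily c.tail (Fin N), ∀ i, ∀ e ∈ (H.walk i).edges, e ∈ p.edges := by
  have hsupp : ∀ v, v ∈ c.tail.support ↔ v ∈ c.support := by
    intro v
    rw [c.support_tail_of_not_nil hc.not_nil]
    refine ⟨List.mem_of_mem_tail, fun h => ?_⟩
    rcases (mem_support_iff c).1 h with rfl | h
    · exact end_mem_tail_support hc.not_nil
    · exact h
  have hedges : ∀ e ∈ c.tail.edges, e ∈ c.edges := by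
    intro e he
    rw [edges_tail] at he
    exact List.mem_of_mem_tail he
  choose hij hjp hi hj hint R hR hpos hRp hRc hRs using hfg
  have hne : ∀ i, p.getVert (f i) ≠ p.getVert (g i) := by
    intro i h
    have h1 : f i = g i := hp.getVert_injOn ((hij i).le.trans (hjp i)) (hjp i) h
    exact (hij i).ne h1
  choose l r hlr hrQ hend R' hR' hlen hRe' hRs' using fun i =>
    exists_oriented hc.isPath_tail ((hsupp _).2 (hi i)) ((hsupp _).2 (hj i)) (hne i) (R i) (hR i)
  have hdis : ∀ i j, i < j → ∀ x, x ∈ (R' i).support → x ∉ (R' j).support := by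
    intro i j h x hxi hxj
    obtain ⟨m, hm, hm', rfl⟩ := hRs i x (hRs' i x hxi)
    obtain ⟨n, hn, hn', hmn⟩ := hRs j _ (hRs' j _ hxj)
    have h1 : m = n := hp.getVert_injOn (hm'.trans (hjp i)) (hn'.trans (hjp j)) hmn
    have := hlt i j h
    omega
  refine ⟨⟨l, r, hlr, hrQ, R', hR', fun i => (hlen i).symm ▸ hpos i, fun i j h x hxi hxj => ?_,
    fun i n hn hx => ?_, fun i e he he' => hRc i e (hRe' i e he) (hedges e he')⟩,
    fun i e he => hRp i e (hRe' i e he)⟩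
  · rcases lt_or_gt_of_ne h with h | h
    · exact hdis i j h x hxi hxj
    · exact hdis j i h x hxj hxi
  · refine hend i n hn ?_
    obtain ⟨m, hm, hm', hnm⟩ := hRs i _ (hRs' i _ hx)
    rcases hm.eq_or_lt with rfl | h1
    · exact Or.inl hnm
    rcases hm'.eq_or_lt with rfl | h2
    · exact Or.inr hnm
    · refine absurd ((hsupp _).1 (c.tail.getVert_mem_support n)) ?_
      rw [hnm]
      exact hint i m h1 h2

/-- Disjoint cycles whose edges lie on two walks weigh together at most as much as the walks. -/
theorem sum_weight_le [DecidableEq V] {a b x y : V} (p : G.Walk a b) (q : G.Walk x y)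
    (w : Sym2 V → ℕ) {K : ℕ} {v : Fin K → V} (D : (i : Fin K) → G.Walk (v i) (v i))
    (hD : ∀ i, (D i).IsCycle)
    (hdis : ∀ i j, i ≠ j → ∀ x, x ∈ (D i).support → x ∉ (D j).support)
    (hedge : ∀ i, ∀ e ∈ (D i).edges, e ∈ p.edges ∨ e ∈ q.edges) :
    ∑ i, ((D i).edges.map w).sum ≤ (p.edges.map w).sum + (q.edges.map w).sum := by
  have hle : ∀ l : List (Sym2 V), ∑ e ∈ l.toFinset, w e ≤ (l.map w).sum := by
    intro l
    rw [Finset.sum_list_map_count]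
    refine Finset.sum_le_sum fun e he => ?_
    have := List.count_pos_iff.2 (List.mem_toFinset.1 he)
    rw [smul_eq_mul]
    exact Nat.le_mul_of_pos_left _ this
  have hpair : Set.PairwiseDisjoint (↑(Finset.univ : Finset (Fin K)))
      (fun i => (D i).edges.toFinset) := by
    intro i _ j _ hij
    refine Finset.disjoint_left.2 fun e hei hej => ?_
    rw [List.mem_toFinset] at hei hej
    exact hdis i j hij _ (mem_support_of_mem_edges_of_mem _ hei e.out_fst_mem)
      (mem_support_of_mem_edges_of_mem _ hej e.out_fst_mem)
  calc ∑ i, ((D i).edges.map w).sum = ∑ i, ∑ e ∈ (D i).edges.toFinset, w e :=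
        Finset.sum_congr rfl fun i _ => (List.sum_toFinset w (hD i).edges_nodup).symm
    _ = ∑ e ∈ Finset.univ.biUnion fun i => (D i).edges.toFinset, w e :=
        (Finset.sum_biUnion hpair).symm
    _ ≤ ∑ e ∈ p.edges.toFinset ∪ q.edges.toFinset, w e := by
        refine Finset.sum_le_sum_of_subset fun e he => ?_
        simp only [Finset.mem_biUnion, Finset.mem_univ, true_and, List.mem_toFinset] at he
        obtain ⟨i, hi⟩ := he
        simpa using hedge i e hi
    _ ≤ ∑ e ∈ p.edges.toFinset, w e + ∑ e ∈ q.edges.toFinset, w e := by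
        rw [← Finset.sum_union_inter]
        exact Nat.le_add_right _ _
    _ ≤ _ := add_le_add (hle _) (hle _)

end SimpleGraph.Walk

/-- Let `(G, w)` be a weighted graph (positive integer edge weights),
`k ≥ 1`, `C` a cycle of weight at most `ℓ`, and `P` a path of weight at most `ℓ` sharing at
least one vertex with `C`.  If `P` has at least `128k³` chords relative to `C`, then `G`
contains `k` pairwise vertex-disjoint cycles of total weight at most `ℓ`.

A chord of `P` relative to `C` is a (maximal) subpath `R` of `P` with at least one edge whose
two endpoints lie on `C`, none of whose internal vertices lies on `C`, and none of whose edges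
is an edge of `C`; chords are identified with their vertex sequences (infixes of the vertex
sequence of `P`). -/
theorem stmt_5 {V : Type*} [Fintype V] [DecidableEq V]
    (G : SimpleGraph V) (w : Sym2 V → ℕ)
    (hw : ∀ e ∈ G.edgeSet, 0 < w e) (k ℓ : ℕ) (hk : 1 ≤ k)
    (u a b : V)
    (c : G.Walk u u) (hc : c.IsCycle) (hcw : (c.edges.map w).sum ≤ ℓ)
    (p : G.Walk a b) (hp : p.IsPath) (hpw : (p.edges.map w).sum ≤ ℓ)
    (hshare : ∃ x, x ∈ p.support ∧ x ∈ c.support)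
    (hchords : 128 * k ^ 3 ≤ Set.ncard {r : List V |
        ∃ (x y : V) (R : G.Walk x y), R.IsPath ∧ 0 < R.length ∧
          R.support.IsInfix p.support ∧
          x ∈ c.support ∧ y ∈ c.support ∧
          (∀ v ∈ R.support, v ≠ x → v ≠ y → v ∉ c.support) ∧
          (∀ e ∈ R.edges, e ∉ c.edges) ∧
          r = R.support}) :
    ∃ (v : Fin k → V) (D : (i : Fin k) → G.Walk (v i) (v i)),
      (∀ i, (D i).IsCycle) ∧
      (∀ i j, i ≠ j → ∀ x, x ∈ (D i).support → x ∉ (D j).support) ∧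
      (∑ i, ((D i).edges.map w).sum) ≤ ℓ := by
  have hfin := Set.finite_of_ncard_pos (lt_of_lt_of_le (by positivity) hchords)
  rw [Set.ncard_eq_toFinset_card _ hfin] at hchords
  have hchord : ∀ r ∈ hfin.toFinset, ∃ i j, Walk.IsChordAt c p i j ∧
      r = (p.support.drop i).take (j - i + 1) := by
    intro r hr
    obtain ⟨x, y, R, hR, hlen, hinf, hx, hy, hint, hedge, rfl⟩ := hfin.mem_toFinset.1 hr
    exact Walk.exists_isChordAt hp hR hlen hinf hx hy hint hedge
  choose! f g hfg hr using hchord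
  have hinj : Set.InjOn f hfin.toFinset := by
    intro r hr₁ r' hr₂ h
    have h1 := hfg r hr₁
    have h2 := hfg r' hr₂
    rw [← h] at h2
    rw [hr r hr₁, hr r' hr₂, ← h, h1.right_unique h2]
  obtain ⟨f', g', hfg', hlt⟩ := Walk.exists_disjoint_isChordAt (c := c) (p := p)
    (hfin.toFinset.image f) (N := 8 * (2 * k) ^ 3)
    (by
      intro i hi
      obtain ⟨r, hr', rfl⟩ := Finset.mem_image.1 hi
      exact ⟨g r, hfg r hr'⟩)
    (by
      rw [Finset.card_image_of_injOn hinj]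
      refine le_trans (le_of_eq ?_) hchords
      ring)
  obtain ⟨H, hH⟩ := Walk.exists_chordFamily hc hp f' g' hfg' hlt
  obtain ⟨v, D, hD, hdis, hedge⟩ := H.hasDisjointCycles (K := 2 * k) hc.isPath_tail (by omega)
    (by simp)
  have hsum := Walk.sum_weight_le c p w D hD hdis fun i e he => by
    rcases hedge i e he with h | ⟨j, h⟩
    · rw [Walk.edges_tail] at h
      exact Or.inl (List.mem_of_mem_tail h)
    · exact Or.inr (hH j e h)
  have htwo : 2 * k = k + k := two_mul k
  have hsplit : ∑ i, ((D i).edges.map w).sum =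
      ∑ i : Fin k, ((D ⟨i, by omega⟩).edges.map w).sum +
        ∑ i : Fin k, ((D ⟨k + i, by omega⟩).edges.map w).sum := by
    rw [← (finCongr htwo.symm).sum_comp, Fin.sum_univ_add]
    rfl
  by_cases hfirst : ∑ i : Fin k, ((D ⟨i, by omega⟩).edges.map w).sum ≤ ℓ
  · exact ⟨_, fun i => D ⟨i, by omega⟩, fun i => hD _,
      fun i j hij => hdis _ _ (by simpa [Fin.ext_iff] using hij), hfirst⟩
  · exact ⟨_, fun i => D ⟨k + i, by omega⟩, fun i => hD _,
      fun i j hij => hdis _ _ (by simpa [Fin.ext_iff] using hij),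
      show ∑ i : Fin k, ((D ⟨k + i, by omega⟩).edges.map w).sum ≤ ℓ by omega⟩
end

section
/- Let (G,w) be a weighted graph, k ≥ 1 an integer, and ℓ ≥ 0. Suppose G does not contain k pairwise vertex-disjoint cycles of total weight at most ℓ. Let C̃ be a subgraph of G that is the union of at most k−1 pairwise vertex-disjoint cycles, each of weight at most ℓ/k, and let P be a path in G of weight at most ℓ. Then the number of connected components of the intersection graph P ∩ C̃ is at most 128k⁴ − 1. -/
open SimpleGraph

/-- A finite set with more than `r * d` elements, carrying a transitive relation,
contains a chain with `r + 1` elements or an antichain with `d + 1` elements. -/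
theorem exists_chain_or_antichain_s9 {ι : Type*} [DecidableEq ι] (R : ι → ι → Prop)
    (htrans : ∀ x y z, R x y → R y z → R x z) (d r : ℕ) (T : Finset ι)
    (hT : r * d < T.card) :
    (∃ c : Fin (r + 1) → ι, (∀ i, c i ∈ T) ∧ ∀ i j, i < j → R (c i) (c j)) ∨
      ∃ A ⊆ T, d < A.card ∧ ∀ x ∈ A, ∀ y ∈ A, ¬ R x y := by
  classical
  induction r generalizing T with
  | zero =>
    obtain ⟨x, hx⟩ : T.Nonempty := Finset.card_pos.1 (by omega)
    exact Or.inl ⟨fun _ => x, fun _ => hx, fun i j hij => by omega⟩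
  | succ r ih =>
    by_cases hA : d < (T.filter fun x => ∀ y ∈ T, ¬ R y x).card
    · refine Or.inr ⟨_, Finset.filter_subset _ _, hA, fun x hx y hy => ?_⟩
      exact (Finset.mem_filter.1 hy).2 x (Finset.mem_filter.1 hx).1
    · have hcard := Finset.card_filter_add_card_filter_not (s := T)
        (fun x => ∀ y ∈ T, ¬ R y x)
      rcases ih (T.filter fun x => ¬ ∀ y ∈ T, ¬ R y x) (by
        rw [Nat.succ_mul] at hT; omega) with ⟨c, hc, hmono⟩ | ⟨A, hAT, h1, h2⟩
      · have h0 := (Finset.mem_filter.1 (hc 0)).2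
        push Not at h0
        obtain ⟨y, hyT, hy⟩ := h0
        have hlt : ∀ i, R y (c i) := by
          intro i
          rcases eq_or_ne i 0 with rfl | hi
          · exact hy
          · exact htrans _ _ _ hy (hmono 0 i (Fin.pos_of_ne_zero hi))
        refine Or.inl ⟨Fin.cons y c, fun i => ?_, fun i j hij => ?_⟩
        · refine Fin.cases hyT (fun i => ?_) i
          exact (Finset.mem_filter.1 (hc i)).1
        · induction j using Fin.cases with
          | zero => exact absurd hij (Fin.not_lt_zero _)
          | succ j =>
            induction i using Fin.cases with
            | zero => simpa using hlt j
            | succ i => simpa using hmono i j (Fin.succ_lt_succ_iff.1 hij)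
      · exact Or.inr ⟨A, hAT.trans (Finset.filter_subset _ _), h1, h2⟩

/-- The graph formed by the edges in `E` with both ends in `U`. -/
def edgeGraphOn {V : Type*} (E : Set (Sym2 V)) (U : Set V) : SimpleGraph V :=
  fromEdgeSet {e | e ∈ E ∧ ∀ x ∈ e, x ∈ U}

theorem edgeGraphOn_adj {V : Type*} {E : Set (Sym2 V)} {U : Set V} {x y : V} :
    (edgeGraphOn E U).Adj x y ↔ s(x, y) ∈ E ∧ x ∈ U ∧ y ∈ U ∧ x ≠ y := by
  simp [edgeGraphOn, and_assoc]

theorem mem_of_mem_edges_edgeGraphOn {V : Type*} {E : Set (Sym2 V)} {U : Set V} {x y : V}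
    (q : (edgeGraphOn E U).Walk x y) {e : Sym2 V} (he : e ∈ q.edges) :
    e ∈ E ∧ ∀ z ∈ e, z ∈ U := by
  have := q.edges_subset_edgeSet he
  induction e with
  | h a b =>
    rw [mem_edgeSet, edgeGraphOn_adj] at this
    refine ⟨this.1, fun z hz => ?_⟩
    rcases Sym2.mem_iff.1 hz with rfl | rfl
    · exact this.2.1
    · exact this.2.2.1

theorem mem_of_mem_support_edgeGraphOn {V : Type*} {E : Set (Sym2 V)} {U : Set V} {x : V}
    {q : (edgeGraphOn E U).Walk x x} (hq : q.IsCycle) {z : V} (hz : z ∈ q.support) : z ∈ U := by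
  rw [Walk.mem_support_iff_exists_mem_edges_of_not_nil hq.not_nil] at hz
  obtain ⟨e, he, hze⟩ := hz
  exact (mem_of_mem_edges_edgeGraphOn q he).2 z hze

/-- If `2k` pairwise disjoint vertex sets all span a cycle within the edge set `E` of weight at
most `2ℓ`, then there are `k` vertex-disjoint cycles of total weight at most `ℓ`. -/
theorem exists_light_disjoint_cycles {V : Type*} [DecidableEq V] (G : SimpleGraph V)
    (w : Sym2 V → ℕ) (E : Finset (Sym2 V)) (hE : ∀ e ∈ E, e ∈ G.edgeSet) (k ℓ : ℕ)
    (hEw : ∑ e ∈ E, w e ≤ 2 * ℓ) (U : Fin (k + k) → Set V)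
    (hU : ∀ r r', r ≠ r' → Disjoint (U r) (U r'))
    (hcyc : ∀ r, ∃ (x : V) (q : (edgeGraphOn (E : Set (Sym2 V)) (U r)).Walk x x), q.IsCycle) :
    ∃ (v : Fin k → V) (D : (i : Fin k) → G.Walk (v i) (v i)),
      (∀ i, (D i).IsCycle) ∧
      (∀ i j, i ≠ j → ∀ x, x ∈ (D i).support → x ∉ (D j).support) ∧
      (∑ i, ((D i).edges.map w).sum) ≤ ℓ := by
  choose x q hq using hcyc
  have hle : ∀ r, edgeGraphOn (E : Set (Sym2 V)) (U r) ≤ G := by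
    intro r a b hab
    exact hE _ (Finset.mem_coe.1 (edgeGraphOn_adj.1 hab).1)
  have hsum : ∑ r, ((q r).edges.map w).sum ≤ 2 * ℓ := by
    refine le_trans ?_ hEw
    have h1 : ∀ r, ((q r).edges.map w).sum = ∑ e ∈ (q r).edges.toFinset, w e := fun r =>
      (List.sum_toFinset w (hq r).isTrail.edges_nodup).symm
    simp only [h1]
    rw [← Finset.sum_biUnion]
    · refine Finset.sum_le_sum_of_subset fun e he => ?_
      simp only [Finset.mem_biUnion, List.mem_toFinset] at he
      obtain ⟨r, -, he⟩ := he
      exact Finset.mem_coe.1 (mem_of_mem_edges_edgeGraphOn _ he).1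
    · intro r _ r' _ hrr
      rw [Function.onFun, Finset.disjoint_left]
      intro e he he'
      rw [List.mem_toFinset] at he he'
      induction e with
      | h a b =>
        exact Set.disjoint_left.1 (hU r r' hrr)
          ((mem_of_mem_edges_edgeGraphOn _ he).2 a (Sym2.mem_mk_left a b))
          ((mem_of_mem_edges_edgeGraphOn _ he').2 a (Sym2.mem_mk_left a b))
  rw [Fin.sum_univ_add] at hsum
  have key : ∀ φ : Fin k → Fin (k + k), Function.Injective φ →
      ∑ i, ((q (φ i)).edges.map w).sum ≤ ℓ →
      ∃ (v : Fin k → V) (D : (i : Fin k) → G.Walk (v i) (v i)),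
      (∀ i, (D i).IsCycle) ∧
      (∀ i j, i ≠ j → ∀ x, x ∈ (D i).support → x ∉ (D j).support) ∧
      (∑ i, ((D i).edges.map w).sum) ≤ ℓ := by
    intro φ hφ hs
    refine ⟨fun i => x (φ i), fun i => (q (φ i)).mapLe (hle _), fun i => (hq _).mapLe _, ?_, ?_⟩
    · intro i j hij z hz hz'
      rw [Walk.support_mapLe_eq_support] at hz hz'
      exact Set.disjoint_left.1 (hU _ _ (hφ.ne hij)) (mem_of_mem_support_edgeGraphOn (hq _) hz)
        (mem_of_mem_support_edgeGraphOn (hq _) hz')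
    · simpa only [Walk.edges_mapLe_eq_edges] using hs
  rcases le_total (∑ i, ((q (Fin.castAdd k i)).edges.map w).sum)
    (∑ i, ((q (Fin.natAdd k i)).edges.map w).sum) with h | h
  · exact key _ (Fin.castAdd_injective k k) (by omega)
  · exact key _ (Fin.natAdd_injective k k) (by omega)

theorem reachable_of_adj_succ {V : Type*} {H : SimpleGraph V} {f : ℕ → V} {a b : ℕ} (hab : a ≤ b)
    (h : ∀ i, a ≤ i → i < b → H.Adj (f i) (f (i + 1))) : H.Reachable (f a) (f b) := by
  induction b, hab using Nat.le_induction with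
  | base => rfl
  | succ b hb ih =>
    exact (ih fun i h1 h2 => h i h1 (by omega)).trans (h b hb (by omega)).reachable

theorem reachable_of_adj_succ_min_max {V : Type*} {H : SimpleGraph V} {f : ℕ → V} {a b : ℕ}
    (h : ∀ i, min a b ≤ i → i < max a b → H.Adj (f i) (f (i + 1))) :
    H.Reachable (f a) (f b) := by
  rcases le_total a b with hab | hab
  · rw [min_eq_left hab, max_eq_right hab] at h
    exact reachable_of_adj_succ hab h
  · rw [min_eq_right hab, max_eq_left hab] at h
    exact (reachable_of_adj_succ hab h).symm

/-- A family of ears of the path `f 0, …, f n`: the `t`-th ear runs along `g` from position `S t`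
to position `E t`, meets the path exactly in its ends `f (A t)` and `f (B t)`, and its first edge
is not an edge of the path. Different ears occupy disjoint intervals of positions of `g`. -/
structure IsEarFamily {V : Type*} (f g : ℕ → V) (n L : ℕ) {M : ℕ} (S E A B : Fin M → ℕ) :
    Prop where
  lt : ∀ t, S t < E t
  lt_length : ∀ t, E t < L
  sep : ∀ t t', t < t' → E t < S t'
  left : ∀ t, f (A t) = g (S t)
  right : ∀ t, f (B t) = g (E t)
  left_le : ∀ t, A t ≤ n
  right_le : ∀ t, B t ≤ n
  interior : ∀ t j, S t < j → j < E t → ∀ i ≤ n, f i ≠ g j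
  first : ∀ t, ∀ i < n, s(f i, f (i + 1)) ≠ s(g (S t), g (S t + 1))

/-- The vertices at the positions `P` of `f` and on the ears `T`. -/
def earRegion {V : Type*} (f g : ℕ → V) {M : ℕ} (S E : Fin M → ℕ) (T : Set (Fin M))
    (P : Set ℕ) : Set V :=
  f '' P ∪ {v | ∃ t ∈ T, ∃ j, S t ≤ j ∧ j ≤ E t ∧ g j = v}

namespace IsEarFamily

variable {V : Type*} {f g : ℕ → V} {n L M : ℕ} {S E A B : Fin M → ℕ}

theorem eq_of_positions (h : IsEarFamily f g n L S E A B) {t t' : Fin M} {j : ℕ}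
    (h1 : S t ≤ j) (h2 : j ≤ E t) (h3 : S t' ≤ j) (h4 : j ≤ E t') : t = t' := by
  rcases lt_trichotomy t t' with hlt | rfl | hlt
  · have := h.sep t t' hlt
    omega
  · rfl
  · have := h.sep t' t hlt
    omega

theorem ends_distinct (h : IsEarFamily f g n L S E A B)
    (hg : ∀ i j, i < L → j < L → g i = g j → i = j) (t t' : Fin M) :
    (A t = A t' → t = t') ∧ (B t = B t' → t = t') ∧ A t ≠ B t' := by
  have h1 := h.lt t
  have h2 := h.lt t'
  have h3 := h.lt_length t
  have h4 := h.lt_length t'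
  refine ⟨fun he => ?_, fun he => ?_, fun he => ?_⟩
  · have := hg (S t) (S t') (by omega) (by omega) (by rw [← h.left, ← h.left, he])
    exact h.eq_of_positions (j := S t) (by omega) (by omega) (by omega) (by omega)
  · have := hg (E t) (E t') (by omega) (by omega) (by rw [← h.right, ← h.right, he])
    exact h.eq_of_positions (j := E t) (by omega) (by omega) (by omega) (by omega)
  · have := hg (S t) (E t') (by omega) (by omega) (by rw [← h.left, ← h.right, he])
    have := h.eq_of_positions (t := t) (t' := t') (j := S t)
      (by omega) (by omega) (by omega) (by omega)
    subst this
    omega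

theorem disjoint_earRegion (h : IsEarFamily f g n L S E A B)
    (hf : ∀ i j, i ≤ n → j ≤ n → f i = f j → i = j)
    (hg : ∀ i j, i < L → j < L → g i = g j → i = j)
    {T T' : Set (Fin M)} {P P' : Set ℕ} (hT : Disjoint T T') (hP : Disjoint P P')
    (hPn : ∀ i ∈ P, i ≤ n) (hPn' : ∀ i ∈ P', i ≤ n)
    (hTP : ∀ t ∈ T, A t ∈ P ∧ B t ∈ P) (hTP' : ∀ t ∈ T', A t ∈ P' ∧ B t ∈ P') :
    Disjoint (earRegion f g S E T P) (earRegion f g S E T' P') := by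
  have key : ∀ i ≤ n, ∀ t j, S t ≤ j → j ≤ E t → g j = f i → i = A t ∨ i = B t := by
    intro i hi t j h1 h2 he
    rcases eq_or_lt_of_le h1 with rfl | h1
    · exact Or.inl (hf _ _ hi (h.left_le t) (by rw [h.left, he]))
    rcases eq_or_lt_of_le h2 with rfl | h2
    · exact Or.inr (hf _ _ hi (h.right_le t) (by rw [h.right, he]))
    exact absurd he.symm (h.interior t j h1 h2 i hi)
  rw [Set.disjoint_left] at hT hP ⊢
  rintro x (⟨i, hi, rfl⟩ | ⟨t, ht, j, h1, h2, rfl⟩) (⟨i', hi', he⟩ | ⟨t', ht', j', h1', h2', he⟩)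
  · have := hf _ _ (hPn' _ hi') (hPn _ hi) he
    subst this
    exact hP hi hi'
  · rcases key i (hPn i hi) t' j' h1' h2' he with rfl | rfl
    · exact hP hi (hTP' t' ht').1
    · exact hP hi (hTP' t' ht').2
  · rcases key i' (hPn' i' hi') t j h1 h2 he.symm with rfl | rfl
    · exact hP (hTP t ht).1 hi'
    · exact hP (hTP t ht).2 hi'
  · have h3 := h.lt_length t
    have h4 := h.lt_length t'
    have := hg _ _ (by omega) (by omega) he
    subst this
    have := h.eq_of_positions h1 h2 h1' h2'
    subst this
    exact hT ht ht'

section Cycle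

variable {D : Set (Sym2 V)} {U : Set V}

theorem adj_path (h : IsEarFamily f g n L S E A B)
    (hf : ∀ i j, i ≤ n → j ≤ n → f i = f j → i = j)
    (hfD : ∀ i < n, s(f i, f (i + 1)) ∈ D) (t : Fin M) {i : ℕ} (hi : i < n)
    (h1 : f i ∈ U) (h2 : f (i + 1) ∈ U) :
    ((edgeGraphOn D U).deleteEdges {s(g (S t), g (S t + 1))}).Adj (f i) (f (i + 1)) := by
  rw [deleteEdges_adj, edgeGraphOn_adj]
  refine ⟨⟨hfD i hi, h1, h2, fun he => ?_⟩, fun he => h.first t i hi he⟩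
  have := hf _ _ (by omega) (by omega) he
  omega

theorem adj_ear (hg : ∀ i j, i < L → j < L → g i = g j → i = j)
    (hgD : ∀ j, j + 1 < L → s(g j, g (j + 1)) ∈ D) {s j : ℕ} (hs : s + 1 < L) (hj : j + 1 < L)
    (hne : j ≠ s) (h1 : g j ∈ U) (h2 : g (j + 1) ∈ U) :
    ((edgeGraphOn D U).deleteEdges {s(g s, g (s + 1))}).Adj (g j) (g (j + 1)) := by
  rw [deleteEdges_adj, edgeGraphOn_adj]
  refine ⟨⟨hgD j hj, h1, h2, fun he => ?_⟩, fun he => ?_⟩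
  · have := hg _ _ (by omega) (by omega) he
    omega
  · rcases Sym2.eq_iff.1 (Set.mem_singleton_iff.1 he) with ⟨h3, -⟩ | ⟨h3, h4⟩
    · exact hne (hg _ _ (by omega) (by omega) h3)
    · have := hg _ _ (by omega) (by omega) h3
      have := hg _ _ (by omega) (by omega) h4
      omega

/-- If the ends of an ear are connected without its first edge, there is a cycle. -/
theorem exists_isCycle (h : IsEarFamily f g n L S E A B)
    (hg : ∀ i j, i < L → j < L → g i = g j → i = j)
    (hgD : ∀ j, j + 1 < L → s(g j, g (j + 1)) ∈ D) (t : Fin M)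
    (hU : ∀ j, S t ≤ j → j ≤ E t → g j ∈ U)
    (hr : ((edgeGraphOn D U).deleteEdges {s(g (S t), g (S t + 1))}).Reachable
      (f (A t)) (f (B t))) :
    ∃ (x : V) (q : (edgeGraphOn D U).Walk x x), q.IsCycle := by
  have h1 := h.lt t
  have h2 := h.lt_length t
  rw [h.left, h.right] at hr
  have h3 : (edgeGraphOn D U).Adj (g (S t)) (g (S t + 1)) := by
    rw [edgeGraphOn_adj]
    refine ⟨hgD _ (by omega), hU _ (by omega) (by omega), hU _ (by omega) (by omega),
      fun he => ?_⟩
    have := hg _ _ (by omega) (by omega) he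
    omega
  have h4 : ((edgeGraphOn D U).deleteEdges {s(g (S t), g (S t + 1))}).Reachable
      (g (S t + 1)) (g (E t)) :=
    reachable_of_adj_succ (by omega) fun i hi hi' =>
      adj_ear hg hgD (by omega) (by omega) (by omega) (hU _ (by omega) (by omega))
        (hU _ (by omega) (by omega))
  obtain ⟨x, q, hq, -⟩ := adj_and_reachable_delete_edges_iff_exists_cycle.1
    ⟨h3, hr.trans h4.symm⟩
  exact ⟨x, q, hq⟩

theorem mem_earRegion_of_position {T : Set (Fin M)} {P : Set ℕ} {i : ℕ} (hi : i ∈ P) :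
    f i ∈ earRegion f g S E T P :=
  Or.inl ⟨i, hi, rfl⟩

theorem mem_earRegion_of_ear {T : Set (Fin M)} {P : Set ℕ} {t : Fin M} (ht : t ∈ T) {j : ℕ}
    (h1 : S t ≤ j) (h2 : j ≤ E t) : g j ∈ earRegion f g S E T P :=
  Or.inr ⟨t, ht, j, h1, h2, rfl⟩

/-- An ear together with the path between its ends contains a cycle. -/
theorem exists_isCycle_of_interval (h : IsEarFamily f g n L S E A B)
    (hf : ∀ i j, i ≤ n → j ≤ n → f i = f j → i = j)
    (hg : ∀ i j, i < L → j < L → g i = g j → i = j)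
    (hfD : ∀ i < n, s(f i, f (i + 1)) ∈ D)
    (hgD : ∀ j, j + 1 < L → s(g j, g (j + 1)) ∈ D) (t : Fin M) {T : Set (Fin M)} {P : Set ℕ}
    (ht : t ∈ T) (hP : ∀ i, min (A t) (B t) ≤ i → i ≤ max (A t) (B t) → i ∈ P) :
    ∃ (x : V) (q : (edgeGraphOn D (earRegion f g S E T P)).Walk x x), q.IsCycle := by
  have := h.left_le t
  have := h.right_le t
  refine h.exists_isCycle hg hgD t (fun j => mem_earRegion_of_ear ht) ?_
  exact reachable_of_adj_succ_min_max fun i h1 h2 => h.adj_path hf hfD t (by omega)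
    (mem_earRegion_of_position (hP _ (by omega) (by omega)))
    (mem_earRegion_of_position (hP _ (by omega) (by omega)))

/-- Two ears together with the path segments joining their lower ends and joining their upper
ends contain a cycle. -/
theorem exists_isCycle_of_pair (h : IsEarFamily f g n L S E A B)
    (hf : ∀ i j, i ≤ n → j ≤ n → f i = f j → i = j)
    (hg : ∀ i j, i < L → j < L → g i = g j → i = j)
    (hfD : ∀ i < n, s(f i, f (i + 1)) ∈ D)
    (hgD : ∀ j, j + 1 < L → s(g j, g (j + 1)) ∈ D) (t t' : Fin M) (hne : t ≠ t')
    {T : Set (Fin M)} {P : Set ℕ} (ht : t ∈ T) (ht' : t' ∈ T) {lo hi : Fin M → ℕ}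
    (hlo : ∀ t, lo t = min (A t) (B t)) (hhi : ∀ t, hi t = max (A t) (B t))
    (hP : ∀ i, min (lo t) (lo t') ≤ i → i ≤ max (lo t) (lo t') → i ∈ P)
    (hP' : ∀ i, min (hi t) (hi t') ≤ i → i ≤ max (hi t) (hi t') → i ∈ P) :
    ∃ (x : V) (q : (edgeGraphOn D (earRegion f g S E T P)).Walk x x), q.IsCycle := by
  have a1 := h.left_le t
  have a2 := h.right_le t
  have a3 := h.left_le t'
  have a4 := h.right_le t'
  have b1 := hlo t
  have b2 := hlo t'
  have b3 := hhi t
  have b4 := hhi t'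
  have c1 := h.lt t
  have c2 := h.lt t'
  have c3 := h.lt_length t
  have c4 := h.lt_length t'
  refine h.exists_isCycle hg hgD t (fun j => mem_earRegion_of_ear ht) ?_
  set H := (edgeGraphOn D (earRegion f g S E T P)).deleteEdges {s(g (S t), g (S t + 1))}
  have r1 : H.Reachable (f (lo t)) (f (lo t')) :=
    reachable_of_adj_succ_min_max fun i h1 h2 => h.adj_path hf hfD t (by omega)
      (mem_earRegion_of_position (hP _ (by omega) (by omega)))
      (mem_earRegion_of_position (hP _ (by omega) (by omega)))
  have r2 : H.Reachable (f (hi t)) (f (hi t')) :=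
    reachable_of_adj_succ_min_max fun i h1 h2 => h.adj_path hf hfD t (by omega)
      (mem_earRegion_of_position (hP' _ (by omega) (by omega)))
      (mem_earRegion_of_position (hP' _ (by omega) (by omega)))
  have r3 : H.Reachable (f (A t')) (f (B t')) := by
    rw [h.left, h.right]
    refine reachable_of_adj_succ c2.le fun j h1 h2 => adj_ear hg hgD (by omega) (by omega) ?_
      (mem_earRegion_of_ear ht' (by omega) (by omega))
      (mem_earRegion_of_ear ht' (by omega) (by omega))
    rintro rfl
    exact hne (h.eq_of_positions le_rfl c1.le h1 h2.le)
  have r4 : H.Reachable (f (lo t')) (f (hi t')) := by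
    rcases le_total (A t') (B t') with hle | hle
    · rwa [b2, b4, min_eq_left hle, max_eq_right hle]
    · rw [b2, b4, min_eq_right hle, max_eq_left hle]
      exact r3.symm
  have r5 : H.Reachable (f (lo t)) (f (hi t)) := r1.trans (r4.trans r2.symm)
  rcases le_total (A t) (B t) with hle | hle
  · rwa [b1, b3, min_eq_left hle, max_eq_right hle] at r5
  · rw [b1, b3, min_eq_right hle, max_eq_left hle] at r5
    exact r5.symm

end Cycle

/-- More than `r (2r + 1)²` ears yield `r + 1` pairwise disjoint vertex sets spanning cycles. -/
theorem exists_disjoint_regions (h : IsEarFamily f g n L S E A B)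
    (hf : ∀ i j, i ≤ n → j ≤ n → f i = f j → i = j)
    (hg : ∀ i j, i < L → j < L → g i = g j → i = j) {D : Set (Sym2 V)}
    (hfD : ∀ i < n, s(f i, f (i + 1)) ∈ D)
    (hgD : ∀ j, j + 1 < L → s(g j, g (j + 1)) ∈ D) (r : ℕ)
    (hM : r * ((2 * r + 1) * (2 * r + 1)) < M) :
    ∃ U : Fin (r + 1) → Set V, (∀ i j, i ≠ j → Disjoint (U i) (U j)) ∧
      ∀ i, ∃ (x : V) (q : (edgeGraphOn D (U i)).Walk x x), q.IsCycle := by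
  classical
  obtain ⟨lo, hlo⟩ : ∃ lo : Fin M → ℕ, ∀ t, lo t = min (A t) (B t) := ⟨_, fun _ => rfl⟩
  obtain ⟨hi, hhi⟩ : ∃ hi : Fin M → ℕ, ∀ t, hi t = max (A t) (B t) := ⟨_, fun _ => rfl⟩
  have hdist : ∀ t t', t ≠ t' → lo t ≠ lo t' ∧ hi t ≠ hi t' ∧ lo t ≠ hi t' := by
    intro t t' hne
    have h1 := h.ends_distinct hg t t'
    have h2 := h.ends_distinct hg t' t
    have h3 := hlo t
    have h4 := hlo t'
    have h5 := hhi t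
    have h6 := hhi t'
    have h7 : A t ≠ A t' := fun he => hne (h1.1 he)
    have h8 : B t ≠ B t' := fun he => hne (h1.2.1 he)
    have h9 := h1.2.2
    have h10 := h2.2.2
    omega
  have hlohi : ∀ t, lo t < hi t := by
    intro t
    have h1 := (h.ends_distinct hg t t).2.2
    have h3 := hlo t
    have h5 := hhi t
    omega
  have hhin : ∀ t, hi t ≤ n := by
    intro t
    have h1 := h.left_le t
    have h2 := h.right_le t
    have h5 := hhi t
    omega
  have hends : ∀ t, (A t = lo t ∧ B t = hi t) ∨ (A t = hi t ∧ B t = lo t) := by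
    intro t
    have h3 := hlo t
    have h5 := hhi t
    omega
  rcases exists_chain_or_antichain_s9 (fun t t' : Fin M => hi t < lo t')
    (fun x y z h1 h2 => by have := hlohi y; omega)
    ((2 * r + 1) * (2 * r + 1)) r Finset.univ (by simpa using hM) with
    ⟨c, -, hc⟩ | ⟨F, -, hF, hanti⟩
  · have hc' : ∀ i j, i ≠ j → hi (c i) < lo (c j) ∨ hi (c j) < lo (c i) := fun i j hij =>
      (lt_or_gt_of_ne hij).imp (hc i j) (hc j i)
    refine ⟨fun i => earRegion f g S E {c i} (Set.Icc (lo (c i)) (hi (c i))),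
      fun i j hij => ?_, fun i => ?_⟩
    · have h1 := hc' i j hij
      have h2 := hlohi (c i)
      have h3 := hlohi (c j)
      refine h.disjoint_earRegion hf hg ?_ ?_ ?_ ?_ ?_ ?_
      · rw [Set.disjoint_singleton]
        intro he
        rw [he] at h1
        omega
      · rw [Set.disjoint_left]
        rintro x ⟨_, _⟩ ⟨_, _⟩
        omega
      · rintro x ⟨_, h4⟩
        exact h4.trans (hhin _)
      · rintro x ⟨_, h4⟩
        exact h4.trans (hhin _)
      · rintro t rfl
        rw [Set.mem_Icc, Set.mem_Icc]
        have := hends (c i)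
        omega
      · rintro t rfl
        rw [Set.mem_Icc, Set.mem_Icc]
        have := hends (c j)
        omega
    · refine h.exists_isCycle_of_interval hf hg hfD hgD (c i) rfl fun x h1 h2 => ?_
      rw [← hlo] at h1
      rw [← hhi] at h2
      exact ⟨h1, h2⟩
  · obtain ⟨c, hcF, hclo, hchi⟩ : ∃ c : Fin (2 * r + 1 + 1) → Fin M, (∀ i, c i ∈ F) ∧
        (∀ i j, i < j → lo (c i) < lo (c j)) ∧
        ((∀ i j, i < j → hi (c i) < hi (c j)) ∨ ∀ i j, i < j → hi (c j) < hi (c i)) := by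
      rcases exists_chain_or_antichain_s9 (fun t t' : Fin M => lo t < lo t' ∧ hi t < hi t')
        (fun x y z h1 h2 => ⟨h1.1.trans h2.1, h1.2.trans h2.2⟩) _ _ F hF with
        ⟨c, hc, hmono⟩ | ⟨F', hF', hcard, hanti'⟩
      · exact ⟨c, hc, fun i j hij => (hmono i j hij).1, Or.inl fun i j hij => (hmono i j hij).2⟩
      · rcases exists_chain_or_antichain_s9 (fun t t' : Fin M => lo t < lo t')
          (fun x y z h1 h2 => h1.trans h2) 1 (2 * r + 1) F' (by simpa using hcard) with
          ⟨c, hc, hmono⟩ | ⟨F'', -, hcard', hanti''⟩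
        · refine ⟨c, fun i => hF' (hc i), hmono, Or.inr fun i j hij => ?_⟩
          have h1 := hmono i j hij
          have h2 := hanti' _ (hc i) _ (hc j)
          have h3 := hdist (c i) (c j) (fun he => by rw [he] at h1; exact lt_irrefl _ h1)
          omega
        · obtain ⟨x, hx, y, hy, hxy⟩ := Finset.one_lt_card.1 hcard'
          have h1 := hanti'' x hx y hy
          have h2 := hanti'' y hy x hx
          have h3 := (hdist x y hxy).1
          omega
    have hcross : ∀ i j, lo (c i) < hi (c j) := by
      intro i j
      by_cases he : c i = c j
      · rw [he]
        exact hlohi _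
      · have h1 := hanti _ (hcF j) _ (hcF i)
        have h2 := (hdist _ _ he).2.2
        omega
    have hcne : ∀ i j, i ≠ j → c i ≠ c j := by
      intro i j hij he
      rcases lt_or_gt_of_ne hij with h1 | h1
      · have := hclo _ _ h1
        rw [he] at this
        omega
      · have := hclo _ _ h1
        rw [he] at this
        omega
    let a : Fin (r + 1) → Fin (2 * r + 1 + 1) := fun i => ⟨2 * i, by omega⟩
    let b : Fin (r + 1) → Fin (2 * r + 1 + 1) := fun i => ⟨2 * i + 1, by omega⟩
    have hab : ∀ i, a i < b i := fun i => by
      rw [Fin.lt_def]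
      exact Nat.lt_succ_self _
    have hba : ∀ i j, i < j → b i < a j := fun i j hij => by
      rw [Fin.lt_def] at hij ⊢
      change 2 * (i : ℕ) + 1 < 2 * (j : ℕ)
      omega
    let P : Fin (r + 1) → Set ℕ := fun i =>
      {x | (lo (c (a i)) ≤ x ∧ x ≤ lo (c (b i))) ∨
        (min (hi (c (a i))) (hi (c (b i))) ≤ x ∧ x ≤ max (hi (c (a i))) (hi (c (b i))))}
    have hPn : ∀ i, ∀ x ∈ P i, x ≤ n := by
      intro i x hx
      have h1 := hhin (c (a i))
      have h2 := hhin (c (b i))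
      have h3 := hlohi (c (b i))
      rcases hx with hx | hx <;> omega
    have hTP : ∀ i, ∀ t ∈ ({c (a i), c (b i)} : Set (Fin M)), A t ∈ P i ∧ B t ∈ P i := by
      intro i t ht
      have h1 := hclo _ _ (hab i)
      have h2 : lo t ∈ P i ∧ hi t ∈ P i := by
        rcases ht with rfl | rfl
        · exact ⟨Or.inl (by omega), Or.inr (by omega)⟩
        · exact ⟨Or.inl (by omega), Or.inr (by omega)⟩
      rcases hends t with ⟨h3, h4⟩ | ⟨h3, h4⟩
      · rw [h3, h4]
        exact h2
      · rw [h3, h4]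
        exact h2.symm
    have hdisj : ∀ i j, i < j → Disjoint (earRegion f g S E {c (a i), c (b i)} (P i))
        (earRegion f g S E {c (a j), c (b j)} (P j)) := by
      intro i j hij
      have o1 := hab i
      have o2 := hab j
      have o3 := hba i j hij
      refine h.disjoint_earRegion hf hg ?_ ?_ (hPn i) (hPn j) (hTP i) (hTP j)
      · rw [Set.disjoint_left]
        rintro t (rfl | rfl) (h1 | h1)
        · exact hcne _ _ (o1.trans o3).ne h1
        · exact hcne _ _ (o1.trans (o3.trans o2)).ne h1
        · exact hcne _ _ o3.ne h1
        · exact hcne _ _ (o3.trans o2).ne h1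
      · have l1 := hclo _ _ o1
        have l2 := hclo _ _ o2
        have l3 := hclo _ _ o3
        have x1 := hcross (b i) (a j)
        have x2 := hcross (b i) (b j)
        have x3 := hcross (b j) (a i)
        have x4 := hcross (b j) (b i)
        rw [Set.disjoint_left]
        intro x hx hx'
        rcases hchi with hm | hm <;>
        · have m1 := hm _ _ o1
          have m2 := hm _ _ o2
          have m3 := hm _ _ o3
          rcases hx with hx | hx <;> rcases hx' with hx' | hx' <;> omega
    refine ⟨fun i => earRegion f g S E {c (a i), c (b i)} (P i), fun i j hij => ?_, fun i => ?_⟩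
    · rcases lt_or_gt_of_ne hij with h1 | h1
      · exact hdisj i j h1
      · exact (hdisj j i h1).symm
    · have l1 := hclo _ _ (hab i)
      refine h.exists_isCycle_of_pair hf hg hfD hgD (c (a i)) (c (b i)) (hcne _ _ (hab i).ne)
        (Or.inl rfl) (Or.inr rfl) hlo hhi (fun x h1 h2 => Or.inl (by omega))
        fun x h1 h2 => Or.inr ⟨h1, h2⟩

end IsEarFamily

/-- Position `j` of `g` is an exit if `g j` lies on the path `f 0, …, f n` but the edge from `g j`
to `g (j + 1)` is not an edge of the path. -/
def IsExit {V : Type*} (f g : ℕ → V) (n j : ℕ) : Prop :=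
  (∃ i ≤ n, f i = g j) ∧ ∀ i < n, s(f i, f (i + 1)) ≠ s(g j, g (j + 1))

theorem exists_isEarFamily {V : Type*} (f g : ℕ → V) (n L M : ℕ) (X : Finset ℕ)
    (hX : ∀ j ∈ X, j < L ∧ IsExit f g n j) (hM : 2 * M ≤ X.card) :
    ∃ S E A B : Fin M → ℕ, IsEarFamily f g n L S E A B := by
  classical
  let o := X.orderEmbOfFin rfl
  have ho : ∀ i, o i ∈ X := X.orderEmbOfFin_mem rfl
  let a : Fin M → Fin X.card := fun t => ⟨2 * t, by omega⟩
  let b : Fin M → Fin X.card := fun t => ⟨2 * t + 1, by omega⟩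
  have hab : ∀ t, o (a t) < o (b t) := fun t => by
    rw [o.lt_iff_lt, Fin.lt_def]
    exact Nat.lt_succ_self _
  have hba : ∀ t t', t < t' → o (b t) < o (a t') := fun t t' htt => by
    rw [Fin.lt_def] at htt
    rw [o.lt_iff_lt, Fin.lt_def]
    change 2 * (t : ℕ) + 1 < 2 * (t' : ℕ)
    omega
  have hex : ∀ t, ∃ j, o (a t) < j ∧ ∃ i ≤ n, f i = g j := fun t =>
    ⟨o (b t), hab t, (hX _ (ho _)).2.1⟩
  have hle : ∀ t, Nat.find (hex t) ≤ o (b t) := fun t =>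
    Nat.find_min' _ ⟨hab t, (hX _ (ho _)).2.1⟩
  choose A hA hA' using fun t => (hX _ (ho (a t))).2.1
  choose B hB hB' using fun t => (Nat.find_spec (hex t)).2
  refine ⟨fun t => o (a t), fun t => Nat.find (hex t), A, B, ?_⟩
  exact
    { lt := fun t => (Nat.find_spec (hex t)).1
      lt_length := fun t => (hle t).trans_lt (hX _ (ho _)).1
      sep := fun t t' htt => (hle t).trans_lt (hba t t' htt)
      left := hA'
      right := hB'
      left_le := hA
      right_le := hB
      interior := fun t j h1 h2 i hi he => Nat.find_min (hex t) h2 ⟨h1, i, hi, he⟩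
      first := fun t => (hX _ (ho (a t))).2.2 }

/-- Some edge of a cycle is missing from any given path. -/
theorem exists_mem_edges_notMem_edges_of_isPath {V : Type*} {G : SimpleGraph V} {a b v : V}
    {p : G.Walk a b} (hp : p.IsPath) {c : G.Walk v v} (hc : c.IsCycle) :
    ∃ e ∈ c.edges, e ∉ p.edges := by
  classical
  by_contra! hsub
  have hadj : ∀ x y, c.toSubgraph.Adj x y →
      ∃ i, i < p.length ∧ ((p.getVert i = x ∧ p.getVert (i + 1) = y) ∨
        (p.getVert i = y ∧ p.getVert (i + 1) = x)) := by
    intro x y hxy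
    have h1 := hsub _ (Walk.adj_toSubgraph_iff_mem_edges.1 hxy)
    rw [← Walk.adj_toSubgraph_iff_mem_edges, Walk.toSubgraph_adj_iff] at h1
    obtain ⟨i, h1, h2⟩ := h1
    exact ⟨i, h2, Sym2.eq_iff.1 h1⟩
  have hinj : ∀ i j, i ≤ p.length → j ≤ p.length → p.getVert i = p.getVert j → i = j :=
    fun i j hi hj he => hp.getVert_injOn hi hj he
  have hnon : ∃ i, i ≤ p.length ∧ p.getVert i ∈ c.support := by
    have h2 := hc.ncard_neighborSet_toSubgraph_eq_two c.start_mem_support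
    obtain ⟨y, hy⟩ := Set.nonempty_of_ncard_ne_zero (h2 ▸ two_ne_zero)
    obtain ⟨i, hi, ⟨h3, -⟩ | ⟨-, h3⟩⟩ := hadj _ _ hy
    · exact ⟨i, hi.le, h3 ▸ c.start_mem_support⟩
    · exact ⟨i + 1, hi, h3 ▸ c.start_mem_support⟩
  obtain ⟨hle, hmem⟩ := Nat.find_spec hnon
  have h2 := hc.ncard_neighborSet_toSubgraph_eq_two hmem
  have h3 : c.toSubgraph.neighborSet (p.getVert (Nat.find hnon)) ⊆
      {p.getVert (Nat.find hnon + 1)} := by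
    intro y hy
    obtain ⟨i, hi, ⟨h4, h5⟩ | ⟨h4, h5⟩⟩ := hadj _ _ hy
    · have := hinj _ _ hi.le hle h4
      rw [Set.mem_singleton_iff, ← h5, this]
    · have h6 := hinj _ _ hi hle h5
      refine absurd ⟨hi.le, ?_⟩ (Nat.find_min hnon (m := i) (by omega))
      rw [h4]
      exact c.mem_verts_toSubgraph.1 (c.toSubgraph.edge_vert hy.symm)
  have h4 := Set.ncard_le_ncard h3 (Set.finite_singleton _)
  rw [Set.ncard_singleton, h2] at h4
  omega

/-- In the intersection of a path with a union of closed walks containing a cycle `c`, every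
vertex of `c` is connected to an exit of `c`. -/
theorem exists_isExit_reachable {V : Type*} {G : SimpleGraph V} {a b v : V}
    {p : G.Walk a b} (hp : p.IsPath) {c : G.Walk v v} (hc : c.IsCycle) {H : G.Subgraph}
    (hcH : c.toSubgraph ≤ H) {x : V} (hx : x ∈ (p.toSubgraph ⊓ H).verts) (hxc : x ∈ c.support) :
    ∃ j, j < c.length ∧ IsExit p.getVert c.getVert p.length j ∧
      ∃ h : c.getVert j ∈ (p.toSubgraph ⊓ H).verts,
        (p.toSubgraph ⊓ H).coe.Reachable ⟨x, hx⟩ ⟨c.getVert j, h⟩ := by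
  by_contra! hno
  let good : V → Prop := fun y => ∃ h : y ∈ (p.toSubgraph ⊓ H).verts,
    (p.toSubgraph ⊓ H).coe.Reachable ⟨x, hx⟩ ⟨y, h⟩
  have hstep : ∀ j, j < c.length → good (c.getVert j) →
      s(c.getVert j, c.getVert (j + 1)) ∈ p.edges ∧ good (c.getVert (j + 1)) := by
    rintro j hj ⟨hy, hr⟩
    have hpj : ∃ i ≤ p.length, p.getVert i = c.getVert j := by
      obtain ⟨i, h1, h2⟩ := Walk.mem_support_iff_exists_getVert.1
        ((Walk.mem_verts_toSubgraph p).1 hy.1)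
      exact ⟨i, h2, h1⟩
    have hne : ¬ IsExit p.getVert c.getVert p.length j := fun he => hno j hj he hy hr
    have hadj : p.toSubgraph.Adj (c.getVert j) (c.getVert (j + 1)) := by
      rw [Walk.toSubgraph_adj_iff]
      by_contra! hcon
      exact hne ⟨hpj, fun i hi he => absurd hi (not_lt.2 (hcon i he))⟩
    have hadj' : (p.toSubgraph ⊓ H).Adj (c.getVert j) (c.getVert (j + 1)) :=
      ⟨hadj, hcH.2 ((Walk.toSubgraph_adj_iff c).2 ⟨j, rfl, hj⟩)⟩
    refine ⟨Walk.adj_toSubgraph_iff_mem_edges.1 hadj, hadj'.snd_mem, hr.trans ?_⟩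
    exact (show (p.toSubgraph ⊓ H).coe.Adj ⟨c.getVert j, hy⟩ ⟨c.getVert (j + 1), hadj'.snd_mem⟩
      from hadj').reachable
  have hrun : ∀ j₀, good (c.getVert j₀) → ∀ j, j₀ ≤ j → j ≤ c.length → good (c.getVert j) := by
    intro j₀ h0 j hj
    induction j, hj using Nat.le_induction with
    | base => exact fun _ => h0
    | succ j _ ih => exact fun hj => (hstep j hj (ih (by omega))).2
  obtain ⟨j₀, h1, h2⟩ := Walk.mem_support_iff_exists_getVert.1 hxc
  have hend : good (c.getVert c.length) := by
    refine hrun j₀ ?_ _ h2 le_rfl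
    rw [h1]
    exact ⟨hx, Reachable.rfl⟩
  have hstart : good (c.getVert 0) := by
    rwa [Walk.getVert_length, ← c.getVert_zero] at hend
  obtain ⟨e, he, he'⟩ := exists_mem_edges_notMem_edges_of_isPath hp hc
  induction e with
  | h y z =>
    rw [← Walk.adj_toSubgraph_iff_mem_edges, Walk.toSubgraph_adj_iff] at he
    obtain ⟨i, h3, h4⟩ := he
    rw [← h3] at he'
    exact he' (hstep i h4 (hrun 0 hstart i (Nat.zero_le _) h4.le)).1

open Classical in
/-- The positions at which the closed walk `c` leaves the path `p`. -/
noncomputable def exits {V : Type*} {G : SimpleGraph V} {a b v : V} (p : G.Walk a b)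
    (c : G.Walk v v) : Finset ℕ :=
  (Finset.range c.length).filter fun j => IsExit p.getVert c.getVert p.length j

theorem mem_exits {V : Type*} {G : SimpleGraph V} {a b v : V} {p : G.Walk a b}
    {c : G.Walk v v} {j : ℕ} :
    j ∈ exits p c ↔ j < c.length ∧ IsExit p.getVert c.getVert p.length j := by
  simp [exits]

/-- The intersection of a path with a union of cycles has at most as many components as there are
exits. -/
theorem card_connectedComponent_le_sum_exits {V : Type*} {G : SimpleGraph V} {a b : V}
    {p : G.Walk a b} (hp : p.IsPath) {m : ℕ} {v : Fin m → V} (c : (i : Fin m) → G.Walk (v i) (v i))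
    (hcyc : ∀ i, (c i).IsCycle) :
    Nat.card ((p.toSubgraph ⊓ ⨆ i, (c i).toSubgraph).coe.ConnectedComponent) ≤
      ∑ i, (exits p (c i)).card := by
  have key : ∀ K : (p.toSubgraph ⊓ ⨆ i, (c i).toSubgraph).coe.ConnectedComponent,
      ∃ y : (i : Fin m) × exits p (c i),
        ∃ h : (c y.1).getVert y.2 ∈ (p.toSubgraph ⊓ ⨆ i, (c i).toSubgraph).verts,
          (p.toSubgraph ⊓ ⨆ i, (c i).toSubgraph).coe.connectedComponentMk ⟨_, h⟩ = K := by
    intro K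
    induction K using ConnectedComponent.ind with
    | h x =>
      obtain ⟨x, hx⟩ := x
      have hx' := hx.2
      rw [Subgraph.verts_iSup, Set.mem_iUnion] at hx'
      obtain ⟨i, hi⟩ := hx'
      obtain ⟨j, h1, h2, h3, h4⟩ := exists_isExit_reachable hp (hcyc i)
        (le_iSup (fun i => (c i).toSubgraph) i) hx ((Walk.mem_verts_toSubgraph _).1 hi)
      exact ⟨⟨i, j, mem_exits.2 ⟨h1, h2⟩⟩, h3, ConnectedComponent.sound h4.symm⟩
  choose φ hφ hφ' using key
  have hinj : Function.Injective φ := by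
    intro K K' he
    rw [← hφ' K, ← hφ' K']
    congr 2
    rw [he]
  refine (Nat.card_le_card_of_injective φ hinj).trans_eq ?_
  rw [Nat.card_eq_fintype_card, Fintype.card_sigma]
  simp

/-- Let `(G, w)` be a weighted graph (positive integer edge weights), `k ≥ 1`
and `ℓ ≥ 0`.  Suppose `G` does not contain `k` pairwise vertex-disjoint cycles of total weight
at most `ℓ`.  Let `C̃` be the subgraph of `G` that is the union of at most `k - 1` pairwise
vertex-disjoint cycles, each of weight at most `ℓ/k` (expressed as `k * weight ≤ ℓ`), and let
`P` be a path of weight at most `ℓ`.  Then the intersection graph `P ∩ C̃` has at most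
`128k⁴ - 1` connected components. -/
theorem stmt_9 {V : Type*} [Fintype V] [DecidableEq V]
    (G : SimpleGraph V) (w : Sym2 V → ℕ)
    (hw : ∀ e ∈ G.edgeSet, 0 < w e) (k ℓ : ℕ) (hk : 1 ≤ k)
    (hno : ¬ ∃ (v : Fin k → V) (D : (i : Fin k) → G.Walk (v i) (v i)),
      (∀ i, (D i).IsCycle) ∧
      (∀ i j, i ≠ j → ∀ x, x ∈ (D i).support → x ∉ (D j).support) ∧
      (∑ i, ((D i).edges.map w).sum) ≤ ℓ)
    (m : ℕ) (hm : m ≤ k - 1)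
    (v : Fin m → V) (c : (i : Fin m) → G.Walk (v i) (v i))
    (hcyc : ∀ i, (c i).IsCycle)
    (hdisj : ∀ i j, i ≠ j → ∀ x, x ∈ (c i).support → x ∉ (c j).support)
    (hcw : ∀ i, k * ((c i).edges.map w).sum ≤ ℓ)
    (a b : V) (p : G.Walk a b) (hp : p.IsPath) (hpw : (p.edges.map w).sum ≤ ℓ) :
    Nat.card ((p.toSubgraph ⊓ ⨆ i, (c i).toSubgraph).coe.ConnectedComponent) ≤
      128 * k ^ 4 - 1 := by
  by_contra! hlt
  have hcard := card_connectedComponent_le_sum_exits hp c hcyc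
  obtain ⟨i, hi⟩ : ∃ i, 2 * (64 * k ^ 3) ≤ (exits p (c i)).card := by
    by_contra! hsmall
    have h1 : ∑ i, (exits p (c i)).card ≤ m * (2 * (64 * k ^ 3)) := by
      refine (Finset.sum_le_card_nsmul Finset.univ _ _ fun i _ => (hsmall i).le).trans_eq ?_
      simp
    have h2 : m * (2 * (64 * k ^ 3)) ≤ (k - 1) * (2 * (64 * k ^ 3)) :=
      Nat.mul_le_mul_right _ hm
    obtain ⟨k', rfl⟩ : ∃ k', k = k' + 1 := ⟨k - 1, by omega⟩
    have h3 : 128 * (k' + 1) ^ 4 = k' * (2 * (64 * (k' + 1) ^ 3)) + 128 * (k' + 1) ^ 3 := by ring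
    have h4 : 0 < (k' + 1) ^ 3 := by positivity
    rw [Nat.add_sub_cancel] at h2
    omega
  obtain ⟨S, E, A, B, hear⟩ := exists_isEarFamily p.getVert (c i).getVert p.length (c i).length
    (64 * k ^ 3) (exits p (c i)) (fun j hj => mem_exits.1 hj) hi
  have hmem : ∀ e, e ∈ p.edges.toFinset ∪ (c i).edges.toFinset ↔
      e ∈ p.edges ∨ e ∈ (c i).edges := by simp
  have hreg : ∃ U : Fin (k + k) → Set V, (∀ i j, i ≠ j → Disjoint (U i) (U j)) ∧
      ∀ r, ∃ (x : V) (q : (edgeGraphOn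
        ((p.edges.toFinset ∪ (c i).edges.toFinset : Finset (Sym2 V)) : Set (Sym2 V))
          (U r)).Walk x x), q.IsCycle := by
    obtain ⟨r, hr⟩ : ∃ r, k + k = r + 1 := ⟨k + k - 1, by omega⟩
    rw [hr]
    refine hear.exists_disjoint_regions (fun x y hx hy he => hp.getVert_injOn hx hy he)
      (fun x y hx hy he => (hcyc i).getVert_injOn' (Nat.le_sub_one_of_lt hx)
        (Nat.le_sub_one_of_lt hy) he) (fun x hx => ?_) (fun x hx => ?_) r ?_
    · rw [Finset.mem_coe, hmem, ← Walk.adj_toSubgraph_iff_mem_edges, Walk.toSubgraph_adj_iff]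
      exact Or.inl ⟨x, rfl, hx⟩
    · rw [Finset.mem_coe, hmem, ← Walk.adj_toSubgraph_iff_mem_edges (p := c i),
        Walk.toSubgraph_adj_iff]
      exact Or.inr ⟨x, rfl, by omega⟩
    · calc r * ((2 * r + 1) * (2 * r + 1)) < (2 * k) * ((4 * k) * (4 * k)) := by
            have h1 : r < 2 * k := by omega
            have h2 : (2 * r + 1) * (2 * r + 1) ≤ (4 * k) * (4 * k) :=
              Nat.mul_le_mul (by omega) (by omega)
            exact Nat.mul_lt_mul_of_lt_of_le h1 h2 (by positivity)
        _ ≤ 64 * k ^ 3 := by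
            have : (2 * k) * ((4 * k) * (4 * k)) = 32 * k ^ 3 := by ring
            omega
  obtain ⟨U, hU, hUc⟩ := hreg
  refine hno (exists_light_disjoint_cycles G w _ (fun e he => ?_) k ℓ ?_ U hU hUc)
  · rcases (hmem e).1 he with h1 | h1
    · exact p.edges_subset_edgeSet h1
    · exact (c i).edges_subset_edgeSet h1
  · have h1 := Finset.sum_union_inter (s₁ := p.edges.toFinset) (s₂ := (c i).edges.toFinset)
      (f := w)
    rw [List.sum_toFinset w hp.isTrail.edges_nodup,
      List.sum_toFinset w (hcyc i).isTrail.edges_nodup] at h1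
    have h2 := (Nat.le_mul_of_pos_left (((c i).edges.map w).sum) hk).trans (hcw i)
    omega
end

section
/- Let C₁ and C₂ be two distinct cycles in a graph such that either they are vertex-disjoint or their intersection graph C₁ ∩ C₂ is a path (possibly a single vertex). Then the union graph C₁ ∪ C₂ has at most two vertices of degree at least 3. -/
open SimpleGraph

/-- Every vertex has at most two neighbours in a cycle. -/
lemma SimpleGraph.Walk.IsCycle.ncard_neighborSet_toSubgraph_le_two {V : Type*}
    {G : SimpleGraph V} {u : V} {c : G.Walk u u} (hc : c.IsCycle) (v : V) :
    (c.toSubgraph.neighborSet v).ncard ≤ 2 := by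
  by_cases hv : v ∈ c.support
  · exact (hc.ncard_neighborSet_toSubgraph_eq_two hv).le
  · have : c.toSubgraph.neighborSet v = ∅ := by
      ext w
      simpa using fun h : c.toSubgraph.Adj v w ↦ hv (c.mem_verts_toSubgraph.mp h.fst_mem)
    simp [this]

/-- A vertex of degree at least `3` in the union of two cycles lies on both cycles and has at most
one neighbour in their intersection. -/
lemma SimpleGraph.Walk.IsCycle.mem_inf_of_three_le_ncard_neighborSet_sup {V : Type*}
    {G : SimpleGraph V} {u₁ u₂ v : V} {c₁ : G.Walk u₁ u₁} {c₂ : G.Walk u₂ u₂}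
    (h₁ : c₁.IsCycle) (h₂ : c₂.IsCycle)
    (hv : 3 ≤ ((c₁.toSubgraph ⊔ c₂.toSubgraph).neighborSet v).ncard) :
    v ∈ (c₁.toSubgraph ⊓ c₂.toSubgraph).verts ∧
      ((c₁.toSubgraph ⊓ c₂.toSubgraph).neighborSet v).ncard ≤ 1 := by
  rw [Subgraph.neighborSet_sup] at hv
  have hle₁ := h₁.ncard_neighborSet_toSubgraph_le_two v
  have hle₂ := h₂.ncard_neighborSet_toSubgraph_le_two v
  have hadd := Set.ncard_union_add_ncard_inter _ _
    (c₁.finite_neighborSet_toSubgraph (w := v)) (c₂.finite_neighborSet_toSubgraph (w := v))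
  refine ⟨⟨?_, ?_⟩, ?_⟩
  · obtain ⟨w, hw⟩ := Set.nonempty_of_ncard_ne_zero
      (s := c₁.toSubgraph.neighborSet v) (by lia)
    exact c₁.toSubgraph.edge_vert hw
  · obtain ⟨w, hw⟩ := Set.nonempty_of_ncard_ne_zero
      (s := c₂.toSubgraph.neighborSet v) (by lia)
    exact c₂.toSubgraph.edge_vert hw
  · rw [Subgraph.neighborSet_inf]
    lia

/-- A vertex of a path with at most one neighbour in it is an endpoint. -/
lemma SimpleGraph.Walk.IsPath.eq_or_eq_of_ncard_neighborSet_le_one {V : Type*}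
    {G : SimpleGraph V} {x y v : V} {r : G.Walk x y} (hr : r.IsPath) (hv : v ∈ r.support)
    (hle : (r.toSubgraph.neighborSet v).ncard ≤ 1) : v = x ∨ v = y := by
  obtain ⟨i, rfl, hi⟩ := Walk.mem_support_iff_exists_getVert.mp hv
  by_contra! hne
  have h₀ : i ≠ 0 := fun h ↦ hne.1 (by simp [h])
  have h₁ : i ≠ r.length := fun h ↦ hne.2 (by simp [h])
  have := hr.ncard_neighborSet_toSubgraph_internal_eq_two h₀ (by lia)
  lia

/-- Let `C₁` and `C₂` be two distinct cycles in a graph such that either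
they are vertex-disjoint or their intersection graph `C₁ ∩ C₂` is a path (possibly a single
vertex).  Then the union graph `C₁ ∪ C₂` has at most two vertices of degree at least `3`
(the degree of `v` being the number of neighbours of `v` in the union subgraph). -/
theorem stmt_14 {V : Type*} [Fintype V] [DecidableEq V]
    (G : SimpleGraph V) (u₁ u₂ : V)
    (c₁ : G.Walk u₁ u₁) (c₂ : G.Walk u₂ u₂)
    (h₁ : c₁.IsCycle) (h₂ : c₂.IsCycle)
    (hne : c₁.toSubgraph ≠ c₂.toSubgraph)
    (hint : (c₁.toSubgraph.verts ∩ c₂.toSubgraph.verts = ∅) ∨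
      ∃ (x y : V) (r : G.Walk x y), r.IsPath ∧
        r.toSubgraph = c₁.toSubgraph ⊓ c₂.toSubgraph) :
    Set.ncard {v : V | 3 ≤ ((c₁.toSubgraph ⊔ c₂.toSubgraph).neighborSet v).ncard} ≤ 2 := by
  have hdeg := fun v ↦ h₁.mem_inf_of_three_le_ncard_neighborSet_sup (v := v) h₂
  obtain hdisj | ⟨x, y, r, hr, hreq⟩ := hint
  · have : {v : V | 3 ≤ ((c₁.toSubgraph ⊔ c₂.toSubgraph).neighborSet v).ncard} = ∅ :=
      Set.eq_empty_of_forall_notMem fun v hv ↦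
        Set.eq_empty_iff_forall_notMem.mp hdisj v (hdeg v hv).1
    rw [this, Set.ncard_empty]
    exact Nat.zero_le 2
  · rw [← hreq] at hdeg
    refine (Set.ncard_le_ncard (t := {x, y}) fun v hv ↦ ?_).trans
      ((Set.ncard_insert_le x {y}).trans (by simp))
    obtain ⟨hmem, hle⟩ := hdeg v hv
    exact hr.eq_or_eq_of_ncard_neighborSet_le_one (r.mem_verts_toSubgraph.mp hmem) hle
end
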